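/- arXiv:2605.16729 — 3 statements merged into one kernel-verified Lean document; each statement's English description precedes it below -/
import Mathlib

section
/- Let r = 2^s be a power of 2 with s ≥ 1. Then the character sum ∑_{x ∈ F_r} Q_r(x) equals −(−1−√−1)^s in ℂ. -/
open Finset

open scoped Classical

noncomputable section

/-- Length-two Witt vectors, with the operations specialised to characteristic two. -/
def W2 (R : Type*) := R × R

namespace W2

variable {R : Type*} [CommRing R]

instance : Zero (W2 R) := ⟨((0, 0) : R × R)⟩

instance : Add (W2 R) := ⟨fun x y => ((x.1 + y.1, x.2 + y.2 + x.1 * y.1) : R × R)⟩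

instance [CharP R 2] : Neg (W2 R) := ⟨fun x => ((x.1, x.2 + x.1 * x.1) : R × R)⟩

theorem fst_add (x y : W2 R) : (x + y).1 = x.1 + y.1 := rfl
theorem snd_add (x y : W2 R) : (x + y).2 = x.2 + y.2 + x.1 * y.1 := rfl
theorem fst_zero : (0 : W2 R).1 = 0 := rfl
theorem snd_zero : (0 : W2 R).2 = 0 := rfl
theorem fst_neg [CharP R 2] (x : W2 R) : (-x).1 = x.1 := rfl
theorem snd_neg [CharP R 2] (x : W2 R) : (-x).2 = x.2 + x.1 * x.1 := rfl

instance [CharP R 2] : AddCommGroup (W2 R) where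
  add := (· + ·)
  zero := 0
  neg := Neg.neg
  add_assoc a b c := Prod.ext_iff.mpr (by
    constructor <;> simp only [fst_add, snd_add] <;> ring)
  zero_add a := Prod.ext_iff.mpr (by
    constructor <;> simp [fst_add, snd_add, fst_zero, snd_zero])
  add_zero a := Prod.ext_iff.mpr (by
    constructor <;> simp [fst_add, snd_add, fst_zero, snd_zero])
  add_comm a b := Prod.ext_iff.mpr (by
    constructor <;> simp only [fst_add, snd_add] <;> ring)
  neg_add_cancel a := Prod.ext_iff.mpr (by
    constructor
    · simp only [fst_add, fst_neg, fst_zero]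
      exact CharTwo.add_self_eq_zero a.1
    · simp only [snd_add, snd_neg, snd_zero, fst_neg]
      rw [show a.2 + a.1 * a.1 + a.2 + a.1 * a.1
            = (a.2 + a.2) + (a.1 * a.1 + a.1 * a.1) by ring]
      rw [CharTwo.add_self_eq_zero, CharTwo.add_self_eq_zero, add_zero])
  nsmul := nsmulRec
  zsmul := zsmulRec

/-- Frobenius on length-two Witt vectors (characteristic two). -/
def frob (x : W2 R) : W2 R := ((x.1 ^ 2, x.2 ^ 2) : R × R)

/-- The Witt-vector trace `Tr_{q/2} = ∑_{i=0}^{n-1} Frobⁱ`. -/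
def tr [CharP R 2] (n : ℕ) (x : W2 R) : W2 R := ∑ i ∈ Finset.range n, frob^[i] x

/-- The additive character of `W₂(𝔽₂)` determined by `ξ₂(1,0) = I`
(for `I` a fixed primitive fourth root of unity), evaluated on Witt vectors
whose components lie in the prime field `𝔽₂ = {0,1}`. -/
def xi (I : ℂ) (x : W2 R) : ℂ := (if x.1 = 0 then 1 else I) * (if x.2 = 0 then 1 else -1)

end W2

variable {K : Type*}

/-- The absolute trace `Tr_{q/2} : 𝔽_q → 𝔽₂`, computed inside `K` (here `q = 2^n`). -/
def tr2 [Field K] (n : ℕ) (x : K) : K := ∑ i ∈ Finset.range n, x ^ 2 ^ i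

/-- The relative trace `Tr_{q/p} : 𝔽_q → 𝔽_p ⊆ 𝔽_q`, computed inside `K`
(here `q = p^m`). -/
def trp [Field K] (p m : ℕ) (x : K) : K := ∑ i ∈ Finset.range m, x ^ p ^ i

/-- The character `ψ_q(x) = (-1)^{Tr_{q/2}(x)}`. -/
def psiq [Field K] (n : ℕ) (x : K) : ℂ := if tr2 n x = 0 then 1 else -1

/-- The map `Q_q(x) = ξ₂(Tr_{q/2}(x,0))` on Witt vectors of length two. -/
def Qq [Field K] [CharP K 2] (I : ℂ) (n : ℕ) (x : K) : ℂ :=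
  W2.xi I (W2.tr n (((x, 0) : K × K) : W2 K))

/-- The unique `2^j`-th root in a perfect field of characteristic two. -/
def rt (L : Type*) [Field L] [ExpChar L 2] [PerfectRing L 2] (j : ℕ) (x : L) : L :=
  (fun y => (frobeniusEquiv L 2).symm y)^[j] x

/-- Evaluation of the `𝔽_p`-linearised polynomial `∑_{i=0}^{e} c_i x^{p^i}`. -/
def Lpoly [Field K] (p e : ℕ) (c : ℕ → K) (x : K) : K :=
  ∑ i ∈ Finset.range (e + 1), c i * x ^ p ^ i

/-- The adjoint `f^*(x) = ∑_{i=0}^{e} (c_i x)^{p^{-i}}` (with `p = 2^k`). -/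
def adj [Field K] [ExpChar K 2] [PerfectRing K 2] (k e : ℕ) (c : ℕ → K) (x : K) : K :=
  ∑ i ∈ Finset.range (e + 1), rt K (k * i) (c i * x)

/-- Evaluation of the `𝔽_p`-linearised polynomial `∑_{i=1}^{e} c_i x^{p^i}`
(no constant-in-`x` coefficient). -/
def LpolyIcc [Field K] (p e : ℕ) (c : ℕ → K) (x : K) : K :=
  ∑ i ∈ Finset.Icc 1 e, c i * x ^ p ^ i

/-- The adjoint `R^*(x) = ∑_{i=1}^{e} (c_i x)^{p^{-i}}` (with `p = 2^k`). -/
def adjIcc [Field K] [ExpChar K 2] [PerfectRing K 2] (k e : ℕ) (c : ℕ → K) (x : K) : K :=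
  ∑ i ∈ Finset.Icc 1 e, rt K (k * i) (c i * x)

/-- The coefficients `a_i = ∑_{j=0}^{e-i} (b_j b_{j+i})^{p^{-j}}` of `R_F` (with `p = 2^k`). -/
def aRF [Field K] [ExpChar K 2] [PerfectRing K 2] (k e : ℕ) (b : ℕ → K) (i : ℕ) : K :=
  ∑ j ∈ Finset.range (e - i + 1), rt K (k * j) (b j * b (j + i))

/-- The linearised polynomial `R_F(x) = ∑_{i=1}^{e} a_i x^{p^i}` (with `p = 2^k`). -/
def RF [Field K] [ExpChar K 2] [PerfectRing K 2] (k e : ℕ) (b : ℕ → K) (x : K) : K :=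
  ∑ i ∈ Finset.Icc 1 e, aRF k e b i * x ^ (2 ^ k) ^ i

/-- `γ_F = ∑_{0 ≤ i < j ≤ e} b_i^{p^{-i}} b_j^{p^{-j}}` (with `p = 2^k`). -/
def gammaF [Field K] [ExpChar K 2] [PerfectRing K 2] (k e : ℕ) (b : ℕ → K) : K :=
  ∑ i ∈ Finset.range (e + 1), ∑ j ∈ Finset.Ioo i (e + 1), rt K (k * i) (b i) * rt K (k * j) (b j)

/-- `α_F(t) = γ_F + F^*(t)²`. -/
def alphaF [Field K] [ExpChar K 2] [PerfectRing K 2] (k e : ℕ) (b : ℕ → K) (t : K) : K :=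
  gammaF k e b + adj k e b t ^ 2

/-- `R_{F,t}(x) = R_F(x) + α_F(t) x`. -/
def RFt [Field K] [ExpChar K 2] [PerfectRing K 2] (k e : ℕ) (b : ℕ → K) (t x : K) : K :=
  RF k e b x + alphaF k e b t * x

/-- The number of affine points of the van der Geer–van der Vlugt curve
`y^p - y = x R(x)` with coordinates in `K`. -/
def Ncount (K : Type*) [Field K] (p : ℕ) (R : K → K) : ℕ :=
  Nat.card {z : K × K // z.2 ^ p - z.2 = z.1 * R z.1}

/-- The adjoint `F^*` of `F(x) = ∑_{i=0}^{e} b_i x^{p^i}`, with coefficients `b_i ∈ K`,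
viewed as a function on the algebraic closure `𝔽` of `K`. -/
def adjBar [Field K] [CharP K 2] (k e : ℕ) (b : ℕ → K) (x : AlgebraicClosure K) : AlgebraicClosure K :=
  adj k e (fun i => algebraMap K (AlgebraicClosure K) (b i)) x

/-- `F(x) = ∑_{i=0}^{e} b_i x^{p^i}`, with coefficients `b_i ∈ K`, viewed as a function on
the algebraic closure `𝔽` of `K` (with `p = 2^k`). -/
def LpolyBar [Field K] [CharP K 2] (k e : ℕ) (b : ℕ → K) (x : AlgebraicClosure K) : AlgebraicClosure K :=
  Lpoly (2 ^ k) e (fun i => algebraMap K (AlgebraicClosure K) (b i)) x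


open Polynomial

/-- Constructor. -/
def wmk {R : Type*} (a b : R) : W2 R := ((a, b) : R × R)

/-- The first two elementary symmetric functions, as a Witt vector. -/
def wv {R : Type*} [CommRing R] (f : R[X]) : W2 R := wmk (f.reverse.coeff 1) (f.reverse.coeff 2)

lemma wv_mul {R : Type*} [CommRing R] [IsDomain R] {f g : R[X]} (hf : f.Monic) (hg : g.Monic) :
    wv (f * g) = wv f + wv g := by
  have h0 : f.reverse.coeff 0 = 1 := by rw [coeff_zero_reverse]; exact hf
  have h1 : g.reverse.coeff 0 = 1 := by rw [coeff_zero_reverse]; exact hg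
  apply Prod.ext
  · simp only [W2.fst_add]
    simp only [wv, wmk, reverse_mul_of_domain, coeff_mul]
    simp [Finset.Nat.antidiagonal_succ, h0, h1]
    ring
  · simp only [W2.snd_add]
    simp only [wv, wmk, reverse_mul_of_domain, coeff_mul]
    simp [Finset.Nat.antidiagonal_succ, h0, h1]
    ring

lemma wv_one {R : Type*} [CommRing R] [IsDomain R] : wv (1 : R[X]) = 0 := by
  apply Prod.ext
  · simp only [W2.fst_zero, wv, wmk]
    rw [← C_1, reverse_C, coeff_C]; simp
  · simp only [W2.snd_zero, wv, wmk]
    rw [← C_1, reverse_C, coeff_C]; simp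

lemma wv_X_sub_C {R : Type*} [CommRing R] [IsDomain R] [CharP R 2] (y : R) :
    wv (X - C y : R[X]) = wmk y 0 := by
  have : (X - C y : R[X]).reverse = 1 - C y * X := by
    rw [sub_eq_add_neg, ← C_neg, reverse_add_C]
    · have := reverse_mul_X (1 : R[X])
      rw [one_mul, ← C_1, reverse_C] at this
      rw [this]
      simp [sub_eq_add_neg]
  unfold wv
  rw [this]
  simp [coeff_one, CharTwo.neg_eq]

lemma wv_prod {R ι : Type*} [CommRing R] [IsDomain R] [CharP R 2] (s : Finset ι) (y : ι → R) :
    wv (∏ i ∈ s, (X - C (y i))) = ∑ i ∈ s, wmk (y i) 0 := by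
  induction s using Finset.induction_on with
  | empty => exact wv_one
  | insert a s ha ih =>
    rw [Finset.prod_insert ha, Finset.sum_insert ha, wv_mul (monic_X_sub_C _)
      (monic_prod_of_monic _ _ fun i _ => monic_X_sub_C _), ih, wv_X_sub_C]

lemma frob_iter {R : Type*} [CommRing R] (x : R) (i : ℕ) :
    W2.frob^[i] (wmk x 0) = wmk (x ^ 2 ^ i) 0 := by
  induction i with
  | zero => simp
  | succ i ih =>
    rw [Function.iterate_succ_apply', ih]
    change wmk ((x ^ 2 ^ i) ^ 2) ((0 : R) ^ 2) = _
    rw [pow_succ 2 i, pow_mul]; simp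

lemma Qq_eq {K : Type*} [Field K] [CharP K 2] (I : ℂ) (n : ℕ) (x : K) :
    Qq I n x = W2.xi I (wv (∏ i ∈ Finset.range n, (X - C (x ^ 2 ^ i)))) := by
  change W2.xi I (∑ i ∈ Finset.range n, W2.frob^[i] (wmk x 0)) = _
  rw [wv_prod]
  simp only [frob_iter]

lemma xi_map {K : Type*} [Field K] [Algebra (ZMod 2) K] (I : ℂ) (f : (ZMod 2)[X]) :
    W2.xi I (wv (f.map (algebraMap (ZMod 2) K))) = W2.xi I (wv f) := by
  have : ∀ i, (f.map (algebraMap (ZMod 2) K)).reverse.coeff i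
      = algebraMap (ZMod 2) K (f.reverse.coeff i) := by
    intro i
    rw [coeff_reverse, coeff_map, coeff_reverse, natDegree_map]
  simp [W2.xi, wv, wmk, this]

lemma xi_add (I : ℂ) (hI : I ^ 2 = -1) (x y : W2 (ZMod 2)) :
    W2.xi I (x + y) = W2.xi I x * W2.xi I y := by
  have hI' : I * I = -1 := by rw [← hI]; ring
  have h2 : (1 : ZMod 2) + 1 = 0 := by decide
  have h01 : ∀ a : ZMod 2, a = 0 ∨ a = 1 := by decide
  simp only [W2.xi, W2.fst_add, W2.snd_add]
  rcases h01 x.1 with h | h <;> rcases h01 x.2 with h' | h' <;>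
  rcases h01 y.1 with k | k <;> rcases h01 y.2 with k' | k' <;>
    simp [h, h', k, k', h2, hI']

/-- The multiplicative function on monic polynomials. -/
def lam (I : ℂ) (f : (ZMod 2)[X]) : ℂ := W2.xi I (wv f)

lemma lam_mul {I : ℂ} (hI : I ^ 2 = -1) {f g : (ZMod 2)[X]} (hf : f.Monic) (hg : g.Monic) :
    lam I (f * g) = lam I f * lam I g := by
  rw [lam, wv_mul hf hg, xi_add I hI]; rfl

lemma lam_one {I : ℂ} : lam I 1 = 1 := by
  rw [lam, wv_one]; simp [W2.xi, W2.fst_zero, W2.snd_zero]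

lemma lam_pow {I : ℂ} (hI : I ^ 2 = -1) {f : (ZMod 2)[X]} (hf : f.Monic) (n : ℕ) :
    lam I (f ^ n) = lam I f ^ n := by
  induction n with
  | zero => simp [lam_one]
  | succ n ih => rw [pow_succ, lam_mul hI (hf.pow n) hf, ih, pow_succ]

section fld
variable {L : Type*} [Field L] [Algebra (ZMod 2) L] [Finite L]

lemma pow_two_pow_eq_iff (x : L) (n : ℕ) : x ^ 2 ^ n = x ↔ (minpoly (ZMod 2) x).natDegree ∣ n := by
  have hi : IsIntegral (ZMod 2) x := Algebra.IsIntegral.isIntegral x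
  rw [(minpoly.irreducible hi).natDegree_dvd_iff_dvd_X_pow_card_pow_sub_X, minpoly.dvd_iff]
  simp [sub_eq_zero]

lemma map_minpoly_eq (x : L) : (minpoly (ZMod 2) x).map (algebraMap (ZMod 2) L) =
    ∏ i ∈ Finset.range (minpoly (ZMod 2) x).natDegree, (X - C (x ^ 2 ^ i)) := by
  have hi : IsIntegral (ZMod 2) x := Algebra.IsIntegral.isIntegral x
  have : CharP L 2 := charP_of_injective_algebraMap (algebraMap (ZMod 2) L).injective 2
  have : Fact (Nat.Prime 2) := ⟨Nat.prime_two⟩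
  set d := (minpoly (ZMod 2) x).natDegree with hd
  apply eq_of_monic_of_dvd_of_natDegree_le
  · exact monic_prod_of_monic _ (fun i => X - C (x ^ 2 ^ i)) fun i _ => monic_X_sub_C _
  · exact (minpoly.monic hi).map _
  · have inj : ∀ i j, i < j → j < d → x ^ 2 ^ i ≠ x ^ 2 ^ j := by
      intro i j hij hj h
      have e : j = (j - i) + i := by omega
      rw [e, pow_add, pow_mul] at h
      have h' := iterateFrobenius_inj L 2 i h
      have := (pow_two_pow_eq_iff x (j - i)).1 h'.symm
      have := Nat.le_of_dvd (by omega) this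
      omega
    refine Finset.prod_dvd_of_coprime (s := fun i => X - C (x ^ 2 ^ i)) ?_ ?_
    · intro i hi j hj hij
      simp only [Finset.coe_range, Set.mem_Iio] at hi hj
      apply isCoprime_X_sub_C_of_isUnit_sub
      rw [isUnit_iff_ne_zero, sub_ne_zero]
      rcases lt_or_gt_of_ne hij with h | h
      · exact inj i j h hj
      · exact (inj j i h hi).symm
    · intro i _
      rw [dvd_iff_isRoot, IsRoot, eval_map_algebraMap]
      have : aeval ((iterateFrobenius L 2 i) x) (minpoly (ZMod 2) x) = 0 := by
        have h := congrArg (iterateFrobenius L 2 i) (minpoly.aeval (ZMod 2) x)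
        rw [map_zero, aeval_def, hom_eval₂] at h
        rw [aeval_def, ← h]
        congr 1
        exact RingHom.ext_zmod _ _
      exact this
  · rw [natDegree_map, natDegree_prod_of_monic _ (fun i => X - C (x ^ 2 ^ i)) fun i _ => monic_X_sub_C _]
    simp only [natDegree_X_sub_C, Finset.sum_const, Finset.card_range, smul_eq_mul, mul_one]
    exact le_rfl

lemma Qq_eq_lam [CharP L 2] {I : ℂ} (hI : I ^ 2 = -1) (x : L) (j : ℕ) :
    Qq I (j * (minpoly (ZMod 2) x).natDegree) x = lam I (minpoly (ZMod 2) x) ^ j := by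
  have hi : IsIntegral (ZMod 2) x := Algebra.IsIntegral.isIntegral x
  rw [Qq_eq, ← lam_pow hI (minpoly.monic hi), lam, ← xi_map (K := L), Polynomial.map_pow]
  congr 2
  induction j with
  | zero => simp
  | succ j ih =>
    rw [add_mul, one_mul, Finset.prod_range_add, ih, pow_succ]
    congr 1
    rw [map_minpoly_eq]
    refine Finset.prod_congr rfl fun i _ => ?_
    rw [pow_add, pow_mul, (pow_two_pow_eq_iff x _).2 (dvd_mul_left _ _)]

lemma card_fiber {k : ℕ} [Fintype L] (hk : Fintype.card L = 2 ^ k) {P : (ZMod 2)[X]} (hP : P.Monic)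
    (hirr : Irreducible P) (hd : P.natDegree ∣ k) :
    (Finset.univ.filter fun x : L => minpoly (ZMod 2) x = P).card = P.natDegree := by
  have hs : (P.map (algebraMap (ZMod 2) L)).Splits := by
    have h := (hirr.natDegree_dvd_iff_dvd_X_pow_card_pow_sub_X).1 hd
    have h2 := FiniteField.splits_X_pow_card_sub_X (K := L) 2
    rw [hk] at h2
    rw [Nat.card_zmod] at h
    refine h2.of_dvd ?_ (Polynomial.map_dvd _ h)
    rw [Ne, Polynomial.map_eq_zero, ← hk]
    exact FiniteField.X_pow_card_sub_X_ne_zero _ Fintype.one_lt_card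
  rw [← card_rootSet_eq_natDegree (PerfectField.separable_of_irreducible hirr) hs, ← Set.toFinset_card]
  congr 1
  ext x
  simp only [Finset.mem_filter, Finset.mem_univ, true_and, Set.mem_toFinset, mem_rootSet]
  constructor
  · rintro rfl
    exact ⟨hirr.ne_zero, minpoly.aeval _ _⟩
  · rintro ⟨_, h⟩
    exact (minpoly.eq_of_irreducible_of_monic hirr h hP).symm

end fld

lemma finite_natDegree_le (n : ℕ) : {f : (ZMod 2)[X] | f.natDegree ≤ n}.Finite := by
  have : Finite (degreeLT (ZMod 2) (n + 1)) :=
    Finite.of_equiv _ (degreeLTEquiv (ZMod 2) (n + 1)).symm.toEquiv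
  refine Set.Finite.subset (Set.toFinite (degreeLT (ZMod 2) (n + 1) : Set (ZMod 2)[X])) ?_
  intro f hf
  simp only [SetLike.mem_coe, mem_degreeLT]
  exact lt_of_le_of_lt degree_le_natDegree (by exact_mod_cast Nat.lt_succ_of_le hf)

/-- Monic polynomials of degree `n`. -/
def Mon (n : ℕ) : Finset (ZMod 2)[X] :=
  (finite_natDegree_le n).toFinset.filter fun f => f.Monic ∧ f.natDegree = n

/-- Monic irreducible polynomials of degree at most `n`. -/
def Irr (n : ℕ) : Finset (ZMod 2)[X] :=
  (finite_natDegree_le n).toFinset.filter fun f => f.Monic ∧ Irreducible f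

lemma mem_Mon {n : ℕ} {f : (ZMod 2)[X]} : f ∈ Mon n ↔ f.Monic ∧ f.natDegree = n := by
  simp only [Mon, Finset.mem_filter, Set.Finite.mem_toFinset, Set.mem_ofPred_eq]
  constructor
  · exact fun h => h.2
  · exact fun h => ⟨h.2.le, h⟩

lemma mem_Irr {n : ℕ} {f : (ZMod 2)[X]} :
    f ∈ Irr n ↔ f.natDegree ≤ n ∧ f.Monic ∧ Irreducible f := by
  simp [Irr]

/-- Sum over monic polynomials. -/
def AA (I : ℂ) (n : ℕ) : ℂ := ∑ f ∈ Mon n, lam I f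

/-- Sum over prime powers of degree `k`. -/
def TT (I : ℂ) (n k : ℕ) : ℂ := ∑ P ∈ Irr n, ∑ j ∈ Finset.Icc 1 n,
  if j * P.natDegree = k then (P.natDegree : ℂ) * lam I P ^ j else 0

lemma sum_Qq {L : Type*} [Field L] [Algebra (ZMod 2) L] [Fintype L] [CharP L 2] {I : ℂ}
    (hI : I ^ 2 = -1) {n k : ℕ} (hk1 : 1 ≤ k) (hkn : k ≤ n) (hk : Fintype.card L = 2 ^ k) :
    ∑ x : L, Qq I k x = TT I n k := by
  have hfr : Module.finrank (ZMod 2) L = k := by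
    have := Module.card_eq_pow_finrank (K := ZMod 2) (V := L)
    rw [hk, ZMod.card] at this
    exact (Nat.pow_right_injective le_rfl this).symm
  have hdvd : ∀ x : L, (minpoly (ZMod 2) x).natDegree ∣ k := fun x => by
    rw [← hfr]; exact minpoly.degree_dvd (Algebra.IsIntegral.isIntegral x)
  have hmem : ∀ x ∈ (Finset.univ : Finset L), minpoly (ZMod 2) x ∈ Irr n := fun x _ => by
    have hi : IsIntegral (ZMod 2) x := Algebra.IsIntegral.isIntegral x
    exact mem_Irr.2 ⟨(Nat.le_of_dvd hk1 (hdvd x)).trans hkn, minpoly.monic hi, minpoly.irreducible hi⟩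
  rw [← Finset.sum_fiberwise_of_maps_to hmem, TT]
  refine Finset.sum_congr rfl fun P hP => ?_
  obtain ⟨hPn, hPm, hPi⟩ := mem_Irr.1 hP
  have hd0 : 0 < P.natDegree := hPi.natDegree_pos
  by_cases hd : P.natDegree ∣ k
  · obtain ⟨j, hj⟩ := hd
    have hj0 : 0 < j := Nat.pos_of_ne_zero (by rintro rfl; omega)
    have hjk : j ≤ k := by rw [hj]; exact Nat.le_mul_of_pos_left _ hd0
    rw [Finset.sum_eq_single j, if_pos (by rw [hj, mul_comm])]
    · rw [Finset.sum_congr rfl (g := fun _ => lam I P ^ j), Finset.sum_const,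
        card_fiber hk hPm hPi ⟨j, hj⟩, nsmul_eq_mul]
      intro x hx
      have hx' := (Finset.mem_filter.1 hx).2
      have := Qq_eq_lam hI x j
      rw [hx', mul_comm, ← hj] at this
      exact this
    · intro b _ hb
      rw [if_neg]
      intro h
      apply hb
      rw [hj, mul_comm] at h
      exact Nat.eq_of_mul_eq_mul_left hd0 h
    · intro h
      exact absurd (Finset.mem_Icc.2 ⟨hj0, hjk.trans hkn⟩) h
  · rw [Finset.sum_eq_zero, Finset.sum_eq_zero]
    · intro j _
      rw [if_neg]
      intro h
      exact hd ⟨j, by rw [← h, mul_comm]⟩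
    · intro x hx
      have hx' := (Finset.mem_filter.1 hx).2
      exact absurd (hx' ▸ hdvd x) hd

lemma TT_eq {I : ℂ} (hI : I ^ 2 = -1) {n k : ℕ} (hk1 : 1 ≤ k) (hkn : k ≤ n) :
    TT I n k = TT I k k := by
  have : Fintype (GaloisField 2 k) := Fintype.ofFinite _
  have hk : Fintype.card (GaloisField 2 k) = 2 ^ k := by
    rw [← Nat.card_eq_fintype_card]; exact GaloisField.card 2 k (by omega)
  rw [← sum_Qq hI hk1 hkn hk, sum_Qq hI hk1 le_rfl hk]

lemma degree_count {n : ℕ} {f : (ZMod 2)[X]} (hf : f ∈ Mon n) :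
    n = ∑ P ∈ Irr n, ∑ j ∈ Finset.Icc 1 n, if P ^ j ∣ f then P.natDegree else 0 := by
  obtain ⟨hfm, hfn⟩ := mem_Mon.1 hf
  have hf0 : f ≠ 0 := hfm.ne_zero
  set s := UniqueFactorizationMonoid.normalizedFactors f with hs
  have hprod : s.prod = f := by
    rw [hs, UniqueFactorizationMonoid.prod_normalizedFactors_eq hf0, hfm.normalize_eq_self]
  have hmon : ∀ P ∈ s, P.Monic := fun P hP => by
    rw [← UniqueFactorizationMonoid.normalize_normalized_factor P hP]
    exact Polynomial.monic_normalize (UniqueFactorizationMonoid.ne_zero_of_mem_normalizedFactors hP)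
  have hdeg : n = (s.map natDegree).sum := by
    rw [← natDegree_multiset_prod_of_monic _ hmon, hprod, hfn]
  have hsub : s.toFinset ⊆ Irr n := by
    intro P hP
    rw [Multiset.mem_toFinset] at hP
    refine mem_Irr.2 ⟨?_, hmon P hP, UniqueFactorizationMonoid.irreducible_of_normalized_factor P hP⟩
    rw [← hfn]
    exact natDegree_le_of_dvd (UniqueFactorizationMonoid.dvd_of_mem_normalizedFactors hP) hf0
  have h1 : n = ∑ P ∈ Irr n, s.count P * P.natDegree := by
    nth_rewrite 1 [hdeg]
    rw [Finset.sum_multiset_map_count]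
    simp only [smul_eq_mul]
    refine Finset.sum_subset hsub fun P _ hP => ?_
    rw [Multiset.mem_toFinset] at hP
    rw [Multiset.count_eq_zero_of_notMem hP, zero_mul]
  nth_rewrite 1 [h1]
  refine Finset.sum_congr rfl fun P hP => ?_
  obtain ⟨hPn, hPm, hPi⟩ := mem_Irr.1 hP
  have hd0 : 0 < P.natDegree := hPi.natDegree_pos
  have hiff : ∀ j, P ^ j ∣ f ↔ j ≤ s.count P := fun j => by
    rw [pow_dvd_iff_le_emultiplicity,
      UniqueFactorizationMonoid.emultiplicity_eq_count_normalizedFactors hPi hf0,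
      hPm.normalize_eq_self]
    exact_mod_cast Iff.rfl
  have hc : s.count P ≤ n := by
    have := natDegree_le_of_dvd ((hiff _).2 le_rfl) hf0
    rw [hPm.natDegree_pow, hfn] at this
    exact (Nat.le_mul_of_pos_right _ hd0).trans this
  simp only [hiff]
  rw [← Finset.sum_filter, Finset.sum_const, smul_eq_mul]
  congr 1
  have : (Finset.Icc 1 n).filter (fun j => j ≤ s.count P) = Finset.Icc 1 (s.count P) := by
    ext j; simp only [Finset.mem_filter, Finset.mem_Icc]; omega
  rw [this]; simp

lemma sum_dvd {I : ℂ} (hI : I ^ 2 = -1) {n : ℕ} {Q : (ZMod 2)[X]} (hQ : Q.Monic) :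
    (∑ f ∈ Mon n, if Q ∣ f then lam I f else 0) =
      if Q.natDegree ≤ n then lam I Q * AA I (n - Q.natDegree) else 0 := by
  rw [← Finset.sum_filter]
  split_ifs with h
  · rw [AA, Finset.mul_sum]
    symm
    refine Finset.sum_bij (fun g _ => Q * g) ?_ ?_ ?_ ?_
    · intro g hg
      obtain ⟨h1, h2⟩ := mem_Mon.1 hg
      rw [Finset.mem_filter, mem_Mon]
      refine ⟨⟨hQ.mul h1, ?_⟩, dvd_mul_right _ _⟩
      rw [hQ.natDegree_mul h1]; omega
    · intro a _ b _ hab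
      exact mul_left_cancel₀ hQ.ne_zero hab
    · intro f hf
      rw [Finset.mem_filter, mem_Mon] at hf
      obtain ⟨⟨h1, h2⟩, g, rfl⟩ := hf
      have hg : g.Monic := hQ.of_mul_monic_left h1
      refine ⟨g, mem_Mon.2 ⟨hg, ?_⟩, rfl⟩
      rw [hQ.natDegree_mul hg] at h2; omega
    · intro g hg
      exact (lam_mul hI hQ (mem_Mon.1 hg).1).symm
  · refine Finset.sum_eq_zero fun f hf => ?_
    rw [Finset.mem_filter, mem_Mon] at hf
    exact absurd (hf.1.2 ▸ natDegree_le_of_dvd hf.2 hf.1.1.ne_zero) h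

lemma newton {I : ℂ} (hI : I ^ 2 = -1) (n : ℕ) :
    (n : ℂ) * AA I n = ∑ k ∈ Finset.Icc 1 n, TT I n k * AA I (n - k) := by
  have h1 : (n : ℂ) * AA I n = ∑ f ∈ Mon n, ∑ P ∈ Irr n, ∑ j ∈ Finset.Icc 1 n,
      (P.natDegree : ℂ) * (if P ^ j ∣ f then lam I f else 0) := by
    rw [AA, Finset.mul_sum]
    refine Finset.sum_congr rfl fun f hf => ?_
    have := congrArg (Nat.cast (R := ℂ)) (degree_count hf)
    rw [this]
    push_cast
    simp only [Finset.sum_mul]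
    refine Finset.sum_congr rfl fun P _ => Finset.sum_congr rfl fun j _ => ?_
    split_ifs <;> simp
  rw [h1, Finset.sum_comm]
  simp only [TT, Finset.sum_mul]
  rw [Finset.sum_comm (s := Finset.Icc 1 n) (t := Irr n)]
  refine Finset.sum_congr rfl fun P hP => ?_
  obtain ⟨hPn, hPm, hPi⟩ := mem_Irr.1 hP
  have hd0 : 0 < P.natDegree := hPi.natDegree_pos
  rw [Finset.sum_comm, Finset.sum_comm (s := Finset.Icc 1 n) (t := Finset.Icc 1 n)]
  refine Finset.sum_congr rfl fun j hj => ?_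
  rw [← Finset.mul_sum, sum_dvd hI (hPm.pow j), hPm.natDegree_pow, lam_pow hI hPm]
  have hj1 := (Finset.mem_Icc.1 hj).1
  simp only [ite_mul, zero_mul]
  rw [Finset.sum_ite_eq]
  have : 1 ≤ j * P.natDegree := Nat.mul_pos hj1 hd0
  simp only [Finset.mem_Icc, this, true_and, mul_ite, mul_zero, mul_assoc]

lemma AA_zero {I : ℂ} : AA I 0 = 1 := by
  have : Mon 0 = {1} := by
    ext f
    rw [mem_Mon, Finset.mem_singleton]
    constructor
    · rintro ⟨h1, h2⟩; exact h1.natDegree_eq_zero.1 h2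
    · rintro rfl; exact ⟨monic_one, natDegree_one⟩
  rw [AA, this, Finset.sum_singleton, lam_one]

lemma lam_X_sub_C {I : ℂ} (y : ZMod 2) : lam I (X - C y) = if y = 0 then 1 else I := by
  rw [lam, wv_X_sub_C]
  by_cases h : y = 0 <;> simp [W2.xi, wmk, h]

lemma AA_one {I : ℂ} : AA I 1 = 1 + I := by
  have : Mon 1 = Finset.univ.image (fun y : ZMod 2 => X - C y) := by
    ext f
    rw [mem_Mon, Finset.mem_image]
    constructor
    · rintro ⟨h1, h2⟩
      refine ⟨- f.coeff 0, Finset.mem_univ _, ?_⟩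
      nth_rewrite 2 [h1.eq_X_add_C h2]
      rw [C_neg, sub_neg_eq_add]
    · rintro ⟨y, -, rfl⟩; exact ⟨monic_X_sub_C _, natDegree_X_sub_C _⟩
  rw [AA, this, Finset.sum_image]
  · simp only [lam_X_sub_C]
    rw [show (Finset.univ : Finset (ZMod 2)) = {0, 1} from rfl, Finset.sum_pair (by decide)]
    simp
  · intro a _ b _ h
    simpa using h

lemma AA_ge_two {I : ℂ} {n : ℕ} (hn : 2 ≤ n) : AA I n = 0 := by
  have hlt : ∀ f : (ZMod 2)[X], f ∈ Mon n → (X ^ (n - 2) : (ZMod 2)[X]).degree < f.degree := by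
    intro f hf
    obtain ⟨h1, h2⟩ := mem_Mon.1 hf
    rw [degree_X_pow, degree_eq_natDegree h1.ne_zero, h2]
    exact_mod_cast (by omega : n - 2 < n)
  have hm : ∀ f : (ZMod 2)[X], f ∈ Mon n → f + X ^ (n - 2) ∈ Mon n := by
    intro f hf
    have h := hlt f hf
    obtain ⟨h1, h2⟩ := mem_Mon.1 hf
    refine mem_Mon.2 ⟨h1.add_of_left h, ?_⟩
    rw [natDegree_add_eq_left_of_degree_lt h, h2]
  have h2 : (X ^ (n - 2) + X ^ (n - 2) : (ZMod 2)[X]) = 0 := CharTwo.add_self_eq_zero _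
  refine Finset.sum_involution (fun f _ => f + X ^ (n - 2)) ?_ ?_ (fun f hf => hm f hf) ?_
  · intro f hf
    have e1 : (f + X ^ (n - 2)).reverse.coeff 1 = f.reverse.coeff 1 := by
      rw [coeff_reverse, coeff_reverse, (mem_Mon.1 hf).2, (mem_Mon.1 (hm f hf)).2,
        revAt_le (by omega), coeff_add, coeff_X_pow, if_neg (by omega), add_zero]
    have e2 : (f + X ^ (n - 2)).reverse.coeff 2 = f.reverse.coeff 2 + 1 := by
      rw [coeff_reverse, coeff_reverse, (mem_Mon.1 hf).2, (mem_Mon.1 (hm f hf)).2,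
        revAt_le (by omega), coeff_add, coeff_X_pow, if_pos rfl]
    simp only [lam, W2.xi, wv, wmk, e1, e2]
    have h01 : ∀ a : ZMod 2, a = 0 ∨ a = 1 := by decide
    have h11 : (1 : ZMod 2) + 1 = 0 := by decide
    rcases h01 (f.reverse.coeff 2) with h | h <;> simp [h, h11]
  · intro f hf _ h
    have : (X ^ (n - 2) : (ZMod 2)[X]) = 0 := by simpa using h
    exact (pow_ne_zero _ X_ne_zero) this
  · intro f hf
    rw [add_assoc, h2, add_zero]

lemma TT_val {I : ℂ} (hI : I ^ 2 = -1) (n : ℕ) : TT I (n + 1) (n + 1) = -(-1 - I) ^ (n + 1) := by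
  induction n with
  | zero =>
    have := newton hI 1
    simp [AA_zero, AA_one] at this
    rw [zero_add, ← this]; ring
  | succ n ih =>
    have h := newton hI (n + 2)
    rw [AA_ge_two (by omega), mul_zero, Finset.sum_Icc_succ_top (by omega),
      Finset.sum_Icc_succ_top (by omega), Finset.sum_eq_zero, TT_eq hI (by omega) (by omega : n + 1 ≤ n + 2), ih,
      Nat.sub_self, AA_zero, show n + 2 - (n + 1) = 1 by omega, AA_one] at h
    · rw [show n + 1 + 1 = n + 2 from rfl, pow_succ]
      linear_combination -h
    · intro k hk
      rw [Finset.mem_Icc] at hk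
      rw [AA_ge_two (by omega), mul_zero]

theorem statement0 {K : Type*} [Field K] [Fintype K] [CharP K 2]
    (s : ℕ) (hs : 1 ≤ s) (hcard : Fintype.card K = 2 ^ s)
    (I : ℂ) (hI : I ^ 2 = -1) :
    ∑ x : K, Qq I s x = -(-1 - I) ^ s := by
  letI : Algebra (ZMod 2) K := ZMod.algebra K 2
  rw [sum_Qq hI hs le_rfl hcard]
  obtain ⟨n, rfl⟩ : ∃ n, s = n + 1 := ⟨s - 1, by omega⟩
  exact TT_val hI n

end
end

section
/- Assume F satisfies conditions (i), (ii), (iii). Then for every t ∈ F_q one has the character-sum identity ∑_{x ∈ F_q} ψ_q(x·R_{F,t}(x)) = −(−1−√−1)^n · ∑_{v ∈ W_F*} Q_q(t+v)^{−1} in ℂ. -/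
open Finset

open scoped Classical

noncomputable section

variable {K : Type*}

section helpers

set_option linter.unusedSectionVars false

/-- Constructor for `W₂`. -/
def mkW {R : Type*} (a c : R) : W2 R := ((a, c) : R × R)

theorem mkW_fst {R : Type*} (a c : R) : (mkW a c).1 = a := rfl
theorem mkW_snd {R : Type*} (a c : R) : (mkW a c).2 = c := rfl

/-- The character of `W₂(𝔽₂)` with values in a general commutative ring. -/
def xiA {A R : Type*} [CommRing A] [CommRing R] (I : A) (x : W2 R) : A :=
  (if x.1 = 0 then 1 else I) * (if x.2 = 0 then 1 else -1)

/-- The trace character of `W₂(K)`. -/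
def EA {A R : Type*} [CommRing A] [CommRing R] [CharP R 2] (I : A) (n : ℕ) (x : W2 R) : A :=
  xiA I (W2.tr n x)

/-- `Q_q` with values in `A`. -/
def QA {A R : Type*} [CommRing A] [CommRing R] [CharP R 2] (I : A) (n : ℕ) (x : R) : A :=
  EA I n (mkW (x) (0))

/-- `ψ_q` with values in `A`. -/
def PA {A R : Type*} [CommRing A] [CommRing R] [CharP R 2] (I : A) (n : ℕ) (x : R) : A :=
  EA I n (mkW (0) (x))

section basics

variable {A R S : Type*} [CommRing A] [CommRing R] [CharP R 2] [CommRing S] [CharP S 2]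

theorem W2ext {x y : W2 R} (h1 : x.1 = y.1) (h2 : x.2 = y.2) : x = y := Prod.ext h1 h2

theorem frob_fst (x : W2 R) : (W2.frob x).1 = x.1 ^ 2 := rfl
theorem frob_snd (x : W2 R) : (W2.frob x).2 = x.2 ^ 2 := rfl

/-- Frobenius as an additive map. -/
def frobHom (R : Type*) [CommRing R] [CharP R 2] : W2 R →+ W2 R where
  toFun := W2.frob
  map_zero' := W2ext (by simp [frob_fst, W2.fst_zero]) (by simp [frob_snd, W2.snd_zero])
  map_add' x y := W2ext (by simp [W2.fst_add, frob_fst, CharTwo.add_sq])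
    (by simp [W2.snd_add, frob_fst, frob_snd, CharTwo.add_sq, mul_pow])

/-- Functoriality of `W₂`. -/
def mapW (φ : R →+* S) : W2 R →+ W2 S where
  toFun x := mkW (φ x.1) (φ x.2)
  map_zero' := W2ext (by simp [mkW_fst, W2.fst_zero]) (by simp [mkW_snd, W2.snd_zero])
  map_add' x y := W2ext (by simp [mkW_fst, W2.fst_add]) (by simp [mkW_fst, mkW_snd, W2.snd_add])

theorem mapW_fst (φ : R →+* S) (x : W2 R) : (mapW φ x).1 = φ x.1 := rfl
theorem mapW_snd (φ : R →+* S) (x : W2 R) : (mapW φ x).2 = φ x.2 := rfl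

theorem frob_iter_s1 (i : ℕ) (x : W2 R) :
    W2.frob^[i] x = (mkW (x.1 ^ 2 ^ i) (x.2 ^ 2 ^ i)) := by
  induction i with
  | zero => apply W2ext <;> simp [mkW_fst, mkW_snd]
  | succ i ih =>
    rw [Function.iterate_succ_apply', ih]
    apply W2ext <;> simp [frob_fst, frob_snd, mkW_fst, mkW_snd, pow_succ, pow_mul]

theorem frob_iter_hom (i : ℕ) (x : W2 R) : W2.frob^[i] x = (frobHom R)^[i] x := rfl

theorem tr_add (n : ℕ) (x y : W2 R) : W2.tr n (x + y) = W2.tr n x + W2.tr n y := by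
  unfold W2.tr
  rw [← Finset.sum_add_distrib]
  refine Finset.sum_congr rfl fun i _ => ?_
  simp only [frob_iter_hom, iterate_map_add]

theorem tr_zero (n : ℕ) : W2.tr n (0 : W2 R) = 0 := by
  have := tr_add n (0 : W2 R) 0
  simpa using this

theorem tr_mapW (φ : R →+* S) (n : ℕ) (x : W2 R) : W2.tr n (mapW φ x) = mapW φ (W2.tr n x) := by
  unfold W2.tr
  rw [map_sum]
  refine Finset.sum_congr rfl fun i _ => ?_
  rw [frob_iter_s1, frob_iter_s1]
  apply W2ext <;> simp [mapW_fst, mapW_snd, mkW_fst, mkW_snd]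

theorem frob_tr (n : ℕ) (hn : ∀ x : R, x ^ 2 ^ n = x) (x : W2 R) :
    W2.frob (W2.tr n x) = W2.tr n x := by
  have h0 : W2.frob (W2.tr n x) = ∑ i ∈ Finset.range n, W2.frob^[i+1] x := by
    change frobHom R _ = _
    unfold W2.tr
    rw [map_sum]
    refine Finset.sum_congr rfl fun i _ => ?_
    rw [Function.iterate_succ_apply']; rfl
  have h1 := Finset.sum_range_succ (fun i => W2.frob^[i] x) n
  rw [Finset.sum_range_succ'] at h1
  have h2 : W2.frob^[n] x = x := by
    rw [frob_iter_s1, hn, hn]; rfl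
  rw [h2] at h1
  simp only [Function.iterate_zero, id] at h1
  rw [h0]
  exact add_right_cancel h1

theorem tr_frob (n : ℕ) (x : W2 R) : W2.tr n (W2.frob x) = W2.frob (W2.tr n x) := by
  change _ = frobHom R _
  unfold W2.tr
  rw [map_sum]
  refine Finset.sum_congr rfl fun i _ => ?_
  rw [← Function.iterate_succ_apply, Function.iterate_succ_apply']; rfl

theorem tr_mul (c d : ℕ) (hd : ∀ x : R, x ^ 2 ^ d = x) (x : W2 R) :
    W2.tr (c * d) x = c • W2.tr d x := by
  induction c with
  | zero => simp [W2.tr]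
  | succ c ih =>
    rw [succ_nsmul, ← ih, Nat.succ_mul]
    unfold W2.tr
    rw [Finset.sum_range_add]
    congr 1
    refine Finset.sum_congr rfl fun i _ => ?_
    rw [add_comm, Function.iterate_add_apply]
    congr 1
    have h : ∀ c : ℕ, ∀ y : R, y ^ 2 ^ (c * d) = y := by
      intro c y
      induction c with
      | zero => simp
      | succ c ih => rw [Nat.succ_mul, pow_add, pow_mul, ih, hd]
    rw [frob_iter_s1, h, h]; rfl

/-- `z` has components in the prime field. -/
def IsP (z : W2 R) : Prop := (z.1 = 0 ∨ z.1 = 1) ∧ (z.2 = 0 ∨ z.2 = 1)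

theorem isP_of_frob [IsDomain R] {z : W2 R} (h : W2.frob z = z) : IsP z := by
  have key : ∀ a : R, a ^ 2 = a → a = 0 ∨ a = 1 := by
    intro a ha
    have : a * (a - 1) = 0 := by linear_combination ha
    rcases mul_eq_zero.mp this with h | h
    · exact Or.inl h
    · exact Or.inr (sub_eq_zero.mp h)
  exact ⟨key _ (congrArg Prod.fst h), key _ (congrArg Prod.snd h)⟩

theorem xiA_add [Nontrivial R] (I : A) (hI : I ^ 2 = -1) {x y : W2 R} (hx : IsP x) (hy : IsP y) :
    xiA I (x + y) = xiA I x * xiA I y := by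
  have h2 : (1 : R) + 1 = 0 := CharTwo.add_self_eq_zero 1
  have hI' : I * I = -1 := by rw [← sq, hI]
  unfold xiA
  rw [W2.fst_add, W2.snd_add]
  rcases hx with ⟨h1 | h1, h3 | h3⟩ <;> rcases hy with ⟨h4 | h4, h5 | h5⟩ <;>
    simp [h1, h3, h4, h5, h2, hI']

theorem xiA_zero (I : A) : xiA I (0 : W2 R) = 1 := by
  simp [xiA, W2.fst_zero, W2.snd_zero]

theorem isP_zero : IsP (0 : W2 R) := ⟨Or.inl rfl, Or.inl rfl⟩

theorem isP_add {x y : W2 R} (hx : IsP x) (hy : IsP y) : IsP (x + y) := by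
  have h2 : (1 : R) + 1 = 0 := CharTwo.add_self_eq_zero 1
  unfold IsP
  rw [W2.fst_add, W2.snd_add]
  rcases hx with ⟨h1 | h1, h3 | h3⟩ <;> rcases hy with ⟨h4 | h4, h5 | h5⟩ <;>
    simp [h1, h3, h4, h5, h2]

theorem isP_nsmul (c : ℕ) {x : W2 R} (hx : IsP x) : IsP (c • x) := by
  induction c with
  | zero => rw [zero_nsmul]; exact isP_zero
  | succ c ih => rw [succ_nsmul]; exact isP_add ih hx

theorem xiA_nsmul [Nontrivial R] (I : A) (hI : I ^ 2 = -1) (c : ℕ) {x : W2 R} (hx : IsP x) :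
    xiA I (c • x) = xiA I x ^ c := by
  induction c with
  | zero => rw [zero_nsmul, xiA_zero, pow_zero]
  | succ c ih => rw [succ_nsmul, xiA_add I hI (isP_nsmul c hx) hx, ih, pow_succ]

theorem xiA_mapW (I : A) (φ : R →+* S) (hφ : Function.Injective φ) (x : W2 R) :
    xiA I (mapW φ x) = xiA I x := by
  simp [xiA, mapW_fst, mapW_snd, map_eq_zero_iff φ hφ]

theorem ringHom_xiA {B : Type*} [CommRing B] (g : A →+* B) (I : A) (x : W2 R) :
    g (xiA I x) = xiA (g I) x := by
  unfold xiA
  split_ifs <;> simp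

end basics

section chars

variable {A K L : Type*} [CommRing A] [Field K] [CharP K 2] [Field L] [CharP L 2]
  {n : ℕ} {I : A}

theorem isP_tr (hn : ∀ x : K, x ^ 2 ^ n = x) (x : W2 K) : IsP (W2.tr n x) :=
  isP_of_frob (frob_tr n hn x)

theorem EA_add (hn : ∀ x : K, x ^ 2 ^ n = x) (hI : I ^ 2 = -1) (x y : W2 K) :
    EA I n (x + y) = EA I n x * EA I n y := by
  unfold EA
  rw [tr_add, xiA_add I hI (isP_tr hn x) (isP_tr hn y)]

theorem EA_frob (hn : ∀ x : K, x ^ 2 ^ n = x) (x : W2 K) :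
    EA I n (W2.frob x) = EA I n x := by
  unfold EA
  rw [tr_frob, frob_tr n hn]

theorem EA_zero : EA I n (0 : W2 K) = 1 := by
  unfold EA; rw [tr_zero, xiA_zero]

theorem QA_zero : QA I n (0 : K) = 1 := EA_zero
theorem PA_zero : PA I n (0 : K) = 1 := EA_zero

theorem PA_add (hn : ∀ x : K, x ^ 2 ^ n = x) (hI : I ^ 2 = -1) (x y : K) :
    PA I n (x + y) = PA I n x * PA I n y := by
  unfold PA
  rw [← EA_add hn hI]
  congr 1
  apply W2ext <;> simp [W2.fst_add, W2.snd_add, mkW_fst, mkW_snd]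

theorem QA_mul (hn : ∀ x : K, x ^ 2 ^ n = x) (hI : I ^ 2 = -1) (x y : K) :
    QA I n x * QA I n y = QA I n (x + y) * PA I n (x * y) := by
  unfold QA PA
  rw [← EA_add hn hI, ← EA_add hn hI]
  congr 1
  apply W2ext <;> simp [W2.fst_add, W2.snd_add, mkW_fst, mkW_snd]

theorem PA_sq (hn : ∀ x : K, x ^ 2 ^ n = x) (x : K) : PA I n (x ^ 2) = PA I n x := by
  unfold PA
  rw [← EA_frob hn (mkW 0 x)]
  congr 1
  apply W2ext <;> simp [frob_fst, frob_snd, mkW_fst, mkW_snd]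

theorem QA_sq (hn : ∀ x : K, x ^ 2 ^ n = x) (x : K) : QA I n (x ^ 2) = QA I n x := by
  unfold QA
  rw [← EA_frob hn (mkW x 0)]
  congr 1
  apply W2ext <;> simp [frob_fst, frob_snd, mkW_fst, mkW_snd]

theorem PA_pow (hn : ∀ x : K, x ^ 2 ^ n = x) (j : ℕ) (x : K) :
    PA I n (x ^ 2 ^ j) = PA I n x := by
  induction j with
  | zero => simp
  | succ j ih => rw [pow_succ, pow_mul, PA_sq hn, ih]

theorem QA_pow (hn : ∀ x : K, x ^ 2 ^ n = x) (j : ℕ) (x : K) :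
    QA I n (x ^ 2 ^ j) = QA I n x := by
  induction j with
  | zero => simp
  | succ j ih => rw [pow_succ, pow_mul, QA_sq hn, ih]

theorem PA_mul_self (hn : ∀ x : K, x ^ 2 ^ n = x) (hI : I ^ 2 = -1) (x : K) :
    PA I n x * PA I n x = 1 := by
  rw [← PA_add hn hI, CharTwo.add_self_eq_zero, PA_zero]

theorem QA_mul_self (hn : ∀ x : K, x ^ 2 ^ n = x) (hI : I ^ 2 = -1) (x : K) :
    QA I n x * QA I n x = PA I n x := by
  rw [QA_mul hn hI, CharTwo.add_self_eq_zero, QA_zero, one_mul, ← sq, PA_sq hn]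

theorem tr_snd (x : K) : W2.tr n (mkW (0) (x)) = (mkW (0) (tr2 n x)) := by
  unfold W2.tr tr2
  induction n with
  | zero => rfl
  | succ n ih =>
    rw [Finset.sum_range_succ, ih, Finset.sum_range_succ, frob_iter_s1]
    apply W2ext <;> simp [W2.fst_add, W2.snd_add, mkW_fst, mkW_snd]

theorem PA_eq (x : K) : PA I n x = if tr2 n x = 0 then 1 else -1 := by
  unfold PA EA
  rw [tr_snd]
  simp only [xiA, mkW_fst, mkW_snd, if_true, one_mul]
  congr

theorem PA_sum (hn : ∀ x : K, x ^ 2 ^ n = x) (hI : I ^ 2 = -1) {ι : Type*} (s : Finset ι)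
    (f : ι → K) : PA I n (∑ i ∈ s, f i) = ∏ i ∈ s, PA I n (f i) := by
  induction s using Finset.induction_on with
  | empty => simp [PA_zero]
  | insert a s ha ih => rw [Finset.sum_insert ha, Finset.prod_insert ha, PA_add hn hI, ih]

theorem QA_map (hI : I ^ 2 = -1) {c d : ℕ} (hd : ∀ x : L, x ^ 2 ^ d = x) (φ : L →+* K) (x : L) :
    QA I (c * d) (φ x) = QA I d x ^ c := by
  have h : (mkW (φ x) (0)) = mapW φ (mkW (x) (0)) := by
    apply W2ext <;> simp [mapW_fst, mapW_snd, mkW_fst, mkW_snd]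
  unfold QA EA
  rw [h, tr_mapW, xiA_mapW I φ φ.injective, tr_mul c d hd, xiA_nsmul I hI c (isP_tr hd _)]

theorem QA_one (hI : I ^ 2 = -1) : QA I n (1 : K) = I ^ n := by
  have h : ∀ i, W2.frob^[i] (mkW (1 : K) 0) = (mkW (1 : K) 0) := by
    intro i
    rw [frob_iter_s1]
    apply W2ext <;> simp [mkW_fst, mkW_snd]
  unfold QA EA W2.tr
  rw [Finset.sum_congr rfl (fun i _ => h i)]
  rw [Finset.sum_const, Finset.card_range, xiA_nsmul I hI]
  · simp [xiA, mkW_fst, mkW_snd]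
  · exact ⟨Or.inr rfl, Or.inl rfl⟩

theorem ringHom_QA {B : Type*} [CommRing B] (g : A →+* B) (I : A) (x : K) :
    g (QA I n x) = QA (g I) n x := ringHom_xiA g I _

theorem ringHom_PA {B : Type*} [CommRing B] (g : A →+* B) (I : A) (x : K) :
    g (PA I n x) = PA (g I) n x := ringHom_xiA g I _

variable [Fintype K]

theorem pow_q (hcard : Fintype.card K = 2 ^ n) (x : K) : x ^ 2 ^ n = x := by
  rw [← hcard]; exact FiniteField.pow_card x

theorem exists_tr2 (hcard : Fintype.card K = 2 ^ n) {a : K} (ha : a ≠ 0) :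
    ∃ x : K, tr2 n (a * x) ≠ 0 := by
  have hr : ringChar K = 2 := ringChar.eq K 2 ▸ rfl
  have : CharP K (ringChar K) := ringChar.charP K
  let _ : Algebra (ZMod (ringChar K)) K := ZMod.algebra K (ringChar K)
  have : Fact (Nat.Prime (ringChar K)) := ⟨hr ▸ Nat.prime_two⟩
  obtain ⟨x, hx⟩ := FiniteField.trace_to_zmod_nondegenerate K ha
  refine ⟨x, ?_⟩
  have h := FiniteField.algebraMap_trace_eq_sum_pow (ZMod (ringChar K)) K (a * x)
  have hf : Module.finrank (ZMod (ringChar K)) K = n := by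
    have h1 := Module.card_eq_pow_finrank (K := ZMod (ringChar K)) (V := K)
    have h2 : Fintype.card (ZMod (ringChar K)) = 2 := by rw [ZMod.card, hr]
    rw [hcard, h2] at h1
    exact (Nat.pow_right_injective le_rfl h1).symm
  rw [hf] at h
  have h3 : tr2 n (a * x) = ∑ i ∈ Finset.range n, (a * x) ^ (Nat.card (ZMod (ringChar K)) ^ i) := by
    unfold tr2
    simp [hr]
  rw [h3, ← h]
  intro h0
  exact hx ((map_eq_zero_iff _ (algebraMap _ K).injective).mp h0)

theorem sum_PA [IsDomain A] [CharZero A] (hI : I ^ 2 = -1) (hcard : Fintype.card K = 2 ^ n) (a : K) :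
    ∑ x : K, PA I n (a * x) = if a = 0 then (2 : A) ^ n else 0 := by
  have hn := pow_q hcard
  split_ifs with ha
  · subst ha
    simp [PA_zero, hcard]
  · obtain ⟨x0, hx0⟩ := exists_tr2 hcard ha
    have h1 : PA I n (a * x0) = -1 := by rw [PA_eq, if_neg hx0]
    have h2 : ∑ x : K, PA I n (a * x) = ∑ x : K, PA I n (a * (x0 + x)) :=
      (Equiv.sum_comp (Equiv.addLeft x0) (fun x => PA I n (a * x))).symm
    simp only [mul_add, PA_add hn hI, h1, neg_one_mul, Finset.sum_neg_distrib] at h2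
    have h3 : (2 : A) * ∑ x : K, PA I n (a * x) = 0 := by linear_combination h2
    exact (mul_eq_zero.mp h3).resolve_left two_ne_zero

end chars
section gauss

theorem sum_fixed {α B : Type*} [Fintype α] [CommRing B] (l : ℕ) [Fact l.Prime] [CharP B l]
    (σ : α → α) (hσ : ∀ x, σ^[l] x = x) (f : α → B) (hf : ∀ x, f (σ x) = f x) :
    ∑ x, f x = ∑ x ∈ Finset.univ.filter (fun x => σ x = x), f x := by
  have h1 : ∀ s : Finset α, ∑ x ∈ s, f x
      = ∑ j ∈ Finset.univ.image f, ((s.filter (fun x => f x = j)).card : B) * j := by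
    intro s
    rw [← Finset.sum_fiberwise_of_maps_to (s := s) (t := Finset.univ.image f) (g := f)
      (fun x _ => Finset.mem_image_of_mem f (Finset.mem_univ x))]
    refine Finset.sum_congr rfl fun j _ => ?_
    rw [Finset.sum_congr rfl (g := fun _ => j) (fun x hx => (Finset.mem_filter.mp hx).2)]
    rw [Finset.sum_const, nsmul_eq_mul]
  rw [h1, h1 (Finset.univ.filter (fun x => σ x = x))]
  refine Finset.sum_congr rfl fun j _ => ?_
  congr 1
  let τ : Function.End {x : α // f x = j} := fun x => ⟨σ x.1, by rw [hf]; exact x.2⟩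
  have hτ : ∀ (c : ℕ) (x : {x : α // f x = j}), ((τ ^ c) x).1 = σ^[c] x.1 := by
    intro c
    induction c with
    | zero => intro x; rfl
    | succ c ih =>
      intro x
      rw [pow_succ, Function.iterate_succ_apply]
      exact ih (τ x)
  have hτ' : τ ^ l ^ 1 = 1 := by
    rw [pow_one]
    funext x
    apply Subtype.ext
    rw [hτ, hσ]; rfl
  have h2 := Equiv.Perm.card_fixedPoints_modEq (p := l) (n := 1) hτ'
  have h3 : Fintype.card {x : α // f x = j} = (Finset.univ.filter (fun x => f x = j)).card :=
    Fintype.card_subtype _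
  have h4 : Fintype.card (Function.fixedPoints τ)
      = ((Finset.univ.filter (fun x => σ x = x)).filter (fun x => f x = j)).card := by
    rw [← Fintype.card_coe]
    refine Fintype.card_congr ⟨fun x => ⟨x.1.1, ?_⟩, fun x => ⟨⟨x.1, ?_⟩, ?_⟩, ?_, ?_⟩
    · have := congrArg Subtype.val x.2
      simp only [Finset.mem_filter, Finset.mem_univ, true_and]
      exact ⟨this, x.1.2⟩
    · exact (Finset.mem_filter.mp x.2).2
    · apply Subtype.ext
      exact (Finset.mem_filter.mp (Finset.mem_filter.mp x.2).1).2
    · intro x; rfl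
    · intro x; rfl
  rw [h3, h4] at h2
  exact (CharP.cast_eq_iff_mod_eq B l).mpr h2

section dom

variable {A K : Type*} [CommRing A] [IsDomain A] [CharZero A] [Field K] [CharP K 2] [Fintype K]
  {n : ℕ} {I : A}

theorem gauss_sq (hI : I ^ 2 = -1) (hcard : Fintype.card K = 2 ^ n) :
    (∑ x : K, QA I n x) ^ 2 = 2 ^ n * I ^ n := by
  have hn := pow_q hcard
  have h1 : ∀ x : K, QA I n x * ∑ y : K, QA I n y
      = ∑ s : K, QA I n s * PA I n ((1 + s) * x) := by
    intro x
    rw [← Equiv.sum_comp (Equiv.addLeft x) (fun y => QA I n y), Finset.mul_sum]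
    refine Finset.sum_congr rfl fun s _ => ?_
    rw [Equiv.coe_addLeft, QA_mul hn hI, ← add_assoc, CharTwo.add_self_eq_zero, zero_add]
    congr 1
    rw [mul_add, add_mul, PA_add hn hI, PA_add hn hI, ← sq, PA_sq hn, one_mul, mul_comm x s]
  rw [sq, Finset.sum_mul, Finset.sum_congr rfl (fun x _ => h1 x), Finset.sum_comm]
  simp only [← Finset.mul_sum, sum_PA hI hcard, mul_ite, mul_zero]
  rw [Finset.sum_eq_single (1 : K)]
  · rw [if_pos (CharTwo.add_self_eq_zero 1), QA_one hI, mul_comm]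
  · intro s _ hs
    rw [if_neg]
    intro h
    exact hs (CharTwo.add_eq_zero.mp h).symm
  · intro h; exact absurd (Finset.mem_univ _) h

theorem PA_half {r : ℕ} {c : K} (hc : c ^ 2 ^ r = c) : PA I (r + r) c = 1 := by
  rw [PA_eq, if_pos]
  unfold tr2
  rw [Finset.sum_range_add]
  simp only [pow_add, pow_mul, hc]
  exact CharTwo.add_self_eq_zero _

theorem tr2_as (r : ℕ) (z : K) : tr2 r (z ^ 2 + z) = z ^ 2 ^ r + z := by
  unfold tr2
  induction r with
  | zero => simp [CharTwo.add_self_eq_zero]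
  | succ r ih =>
    rw [Finset.sum_range_succ, ih, add_pow_char_pow, ← pow_mul, ← pow_succ']
    linear_combination (z ^ 2 ^ r) * CharTwo.two_eq_zero (R := K)

theorem QA_half (hI : I ^ 2 = -1) {r : ℕ} {z : K} (hz : 1 + (z + z ^ 2 ^ r) = 0) :
    QA I (r + r) z = - I ^ r := by
  have h1 : z + z ^ 2 ^ r = 1 := (CharTwo.add_eq_zero.mp hz).symm
  have h2 : W2.tr (r + r) (mkW z 0) = W2.tr r (mkW 1 0) + W2.tr r (mkW 0 (z ^ 2 + z)) := by
    have : W2.tr (r + r) (mkW z 0) = W2.tr r (mkW z 0) + W2.tr r (W2.frob^[r] (mkW z 0)) := by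
      unfold W2.tr
      rw [Finset.sum_range_add]
      simp only [add_comm r, Function.iterate_add_apply]
    rw [this, ← tr_add, ← tr_add, frob_iter_s1]
    congr 1
    have h3 : z ^ 2 ^ r = 1 + z := by
      linear_combination h1 - z * CharTwo.two_eq_zero (R := K)
    apply W2ext
    · simp [W2.fst_add, mkW_fst, h1]
    · simp [W2.snd_add, mkW_fst, mkW_snd, h3]
      ring
  have h3 : W2.tr r (mkW (1 : K) 0) = r • mkW (1 : K) 0 := by
    unfold W2.tr
    rw [Finset.sum_congr rfl (g := fun _ => mkW (1 : K) 0), Finset.sum_const, Finset.card_range]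
    intro i _
    rw [frob_iter_s1]
    apply W2ext <;> simp [mkW_fst, mkW_snd]
  have hp : IsP (mkW (1 : K) 0) := ⟨Or.inr rfl, Or.inl rfl⟩
  have hp2 : IsP (mkW (0 : K) 1) := ⟨Or.inl rfl, Or.inr rfl⟩
  unfold QA EA
  rw [h2, h3, tr_snd, tr2_as, add_comm _ z, h1, xiA_add I hI (isP_nsmul r hp) hp2,
    xiA_nsmul I hI r hp]
  simp [xiA, mkW_fst, mkW_snd]

theorem gauss_even (hI : I ^ 2 = -1) {r : ℕ} (hcard : Fintype.card K = 2 ^ (r + r)) :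
    ∑ x : K, QA I (r + r) x = -(-1 - I) ^ (r + r) := by
  have hn := pow_q hcard
  have hss : ∀ u : K, (u ^ 2 ^ r) ^ 2 ^ r = u := by
    intro u
    rw [← pow_mul, ← pow_add, hn]
  have h1 : ∀ u : K, ∑ x : K, QA I (r + r) x
      = ∑ z : K, QA I (r + r) z * PA I (r + r) ((1 + (z + z ^ 2 ^ r)) * u) := by
    intro u
    rw [← Equiv.sum_comp (Equiv.addRight (u + u ^ 2 ^ r)) (fun y => QA I (r + r) y)]
    refine Finset.sum_congr rfl fun z _ => ?_
    rw [Equiv.coe_addRight]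
    have e1 := QA_mul hn hI z (u + u ^ 2 ^ r)
    have e2 := QA_mul hn hI u (u ^ 2 ^ r)
    rw [QA_pow hn, QA_mul_self hn hI, PA_half (c := u * u ^ 2 ^ r)
      (by rw [mul_pow, hss, mul_comm]), mul_one] at e2
    have e3 := PA_mul_self hn hI (z * (u + u ^ 2 ^ r))
    have e4 : PA I (r + r) (z * u ^ 2 ^ r) = PA I (r + r) (z ^ 2 ^ r * u) := by
      rw [← PA_pow hn r (z * u ^ 2 ^ r), mul_pow, hss]
    have e5 : PA I (r + r) ((1 + (z + z ^ 2 ^ r)) * u)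
        = PA I (r + r) u * PA I (r + r) (z * (u + u ^ 2 ^ r)) := by
      rw [add_mul, add_mul, mul_add, PA_add hn hI, PA_add hn hI, PA_add hn hI, one_mul, e4]
    rw [e5, e2]
    linear_combination (-PA I (r + r) (z * (u + u ^ 2 ^ r))) * e1
      - QA I (r + r) (z + (u + u ^ 2 ^ r)) * e3
  have h2 : (2 : A) ^ (r + r) * ∑ x : K, QA I (r + r) x
      = 2 ^ (r + r) * (((Finset.univ.filter (fun z : K => 1 + (z + z ^ 2 ^ r) = 0)).card : A)
        * (- I ^ r)) := by
    have : (2 : A) ^ (r + r) * ∑ x : K, QA I (r + r) x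
      = ∑ u : K, ∑ x : K, QA I (r + r) x := by
      rw [Finset.sum_const, Finset.card_univ, hcard, nsmul_eq_mul]; push_cast; rfl
    rw [this, Finset.sum_congr rfl (fun u _ => h1 u), Finset.sum_comm]
    simp only [← Finset.mul_sum, sum_PA hI hcard, mul_ite, mul_zero]
    rw [← Finset.sum_filter, Finset.sum_congr rfl
      (g := fun _ => (- I ^ r) * (2 : A) ^ (r + r))]
    · rw [Finset.sum_const, nsmul_eq_mul]; ring
    · intro z hz
      rw [QA_half hI (Finset.mem_filter.mp hz).2]
  have h3 := mul_left_cancel₀ (pow_ne_zero _ (two_ne_zero (α := A))) h2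
  set N := (Finset.univ.filter (fun z : K => 1 + (z + z ^ 2 ^ r) = 0)).card
  have h4 := gauss_sq hI hcard
  have hI0 : I ≠ 0 := by
    rintro rfl
    simp at hI
  have h5 : ((N ^ 2 : ℕ) : A) = ((2 ^ r) ^ 2 : ℕ) := by
    apply mul_right_cancel₀ (pow_ne_zero (r + r) hI0)
    push_cast
    rw [h3] at h4
    linear_combination h4
  have h6 : N = 2 ^ r := by
    have := Nat.cast_injective h5
    exact Nat.pow_left_injective (by norm_num : (2:ℕ) ≠ 0) this
  rw [h3, h6, ← two_mul, pow_mul]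
  have : (-1 - I) ^ 2 = 2 * I := by linear_combination hI
  rw [this, mul_pow]
  push_cast
  ring

theorem gauss_one (hcard : Fintype.card K = 2 ^ 1) (hI : I ^ 2 = -1) :
    ∑ x : K, QA I 1 x = -(-1 - I) ^ 1 := by
  have h : (Finset.univ : Finset K) = {0, 1} := by
    symm
    apply Finset.eq_univ_of_card
    rw [Finset.card_pair zero_ne_one, hcard]; norm_num
  rw [h, Finset.sum_pair zero_ne_one, QA_zero, QA_one hI]
  ring

end dom

theorem gauss_step {K L : Type*} [Field K] [CharP K 2] [Fintype K] [Field L] [CharP L 2] [Fintype L]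
    (φ : L →+* K) (l d : ℕ) (hl : l.Prime) (hl2 : l ≠ 2) (hodd : Odd d)
    (hK : Fintype.card K = 2 ^ (l * d)) (hL : Fintype.card L = 2 ^ d)
    {I : GaussianInt} (hI : I ^ 2 = -1)
    (ih : ∑ x : L, QA I d x = -(-1 - I) ^ d) :
    ∑ x : K, QA I (l * d) x = -(-1 - I) ^ (l * d) := by
  have hn := pow_q hK
  have hd := pow_q hL
  have hlodd : Odd l := hl.odd_of_ne_two hl2
  have : Fact l.Prime := ⟨hl⟩
  let J : Ideal GaussianInt := Ideal.span {(l : GaussianInt)}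
  let g : GaussianInt →+* GaussianInt ⧸ J := Ideal.Quotient.mk J
  have hchar : CharP (GaussianInt ⧸ J) l := by
    have hlz : (l : GaussianInt ⧸ J) = 0 := by
      have : g (l : GaussianInt) = 0 :=
        Ideal.Quotient.eq_zero_iff_mem.mpr (Ideal.mem_span_singleton_self _)
      simpa using this
    have hnt : Nontrivial (GaussianInt ⧸ J) := by
      apply Ideal.Quotient.nontrivial_iff.mpr
      intro h
      rw [Ideal.span_singleton_eq_top] at h
      have h1 := h.dvd (a := (1 : GaussianInt))
      have h2 : ((l : ℤ) : GaussianInt) ∣ ((1 : ℤ) : GaussianInt) := by simpa using h1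
      rw [Zsqrtd.intCast_dvd_intCast] at h2
      have h3 : l ∣ 1 := by exact_mod_cast h2
      exact hl.one_lt.ne' (Nat.dvd_one.mp h3)
    exact ringChar.of_eq (CharP.ringChar_of_prime_eq_zero hl hlz)
  have hgI : (g I) ^ 2 = -1 := by rw [← map_pow, hI]; simp
  have hfix : (Finset.univ.filter (fun x : K => x ^ 2 ^ d = x)) = Finset.univ.image φ := by
    symm
    apply Finset.eq_of_subset_of_card_le
    · intro x hx
      obtain ⟨y, -, rfl⟩ := Finset.mem_image.mp hx
      simp only [Finset.mem_filter, Finset.mem_univ, true_and]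
      rw [← map_pow, hd]
    · rw [Finset.card_image_of_injective _ φ.injective, Finset.card_univ, hL]
      have hd0 : d ≠ 0 := hodd.pos.ne'
      have hne := FiniteField.X_pow_card_pow_sub_X_ne_zero K hd0 (p := 2) one_lt_two
      have hdeg := FiniteField.X_pow_card_pow_sub_X_natDegree_eq K hd0 (p := 2) one_lt_two
      refine le_trans (b := (Polynomial.X ^ 2 ^ d - Polynomial.X : Polynomial K).natDegree) ?_ hdeg.le
      refine le_trans (Finset.card_le_card ?_) (le_trans (Multiset.toFinset_card_le _)
        (Polynomial.card_roots' _))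
      intro x hx
      rw [Multiset.mem_toFinset, Polynomial.mem_roots hne]
      simpa [sub_eq_zero] using hx
  have hiter : ∀ (c : ℕ) (x : K), (fun y : K => y ^ 2 ^ d)^[c] x = x ^ 2 ^ (c * d) := by
    intro c
    induction c with
    | zero => intro x; simp
    | succ c ih => intro x; rw [Function.iterate_succ_apply, ih, ← pow_mul, ← pow_add]; congr 2; ring
  have h1 : ∑ x : K, QA (g I) (l * d) x = (∑ x : L, QA (g I) d x) ^ l := by
    rw [sum_fixed l (fun y : K => y ^ 2 ^ d) (fun x => by rw [hiter, hn]) _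
      (fun x => QA_pow hn d x), hfix, Finset.sum_image (fun a _ b _ h => φ.injective h)]
    rw [sum_pow_char]
    refine Finset.sum_congr rfl fun x _ => ?_
    rw [QA_map hgI hd]
  have h2 : g (∑ x : K, QA I (l * d) x) = g (-(-1 - I) ^ (l * d)) := by
    rw [map_sum, Finset.sum_congr rfl (fun x _ => ringHom_QA g I x), h1,
      Finset.sum_congr rfl (fun x _ => (ringHom_QA g I x).symm), ← map_sum, ih, ← map_pow]
    rw [hlodd.neg_pow, ← pow_mul, mul_comm d l]
  have h3 : (∑ x : K, QA I (l * d) x) ^ 2 = (-(-1 - I) ^ (l * d)) ^ 2 := by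
    rw [gauss_sq hI hK, neg_sq, ← pow_mul, mul_comm (l * d) 2, pow_mul (-1 - I),
      show (-1 - I) ^ 2 = 2 * I by linear_combination hI, mul_pow]
  rcases sq_eq_sq_iff_eq_or_eq_neg.mp h3 with h | h
  · exact h
  · exfalso
    rw [h] at h2
    have h4 : g (2 * (-1 - I) ^ (l * d)) = 0 := by
      have : g (2 * (-1 - I) ^ (l * d)) = g (-(-(-1 - I) ^ (l * d))) - g (-(-1 - I) ^ (l * d)) := by
        rw [← map_sub]; congr 1; ring
      rw [this, h2, sub_self]
    have h5 : (l : GaussianInt) ∣ 2 * (-1 - I) ^ (l * d) :=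
      Ideal.mem_span_singleton.mp (Ideal.Quotient.eq_zero_iff_mem.mp h4)
    have h6 : (l : GaussianInt) ∣ 2 * (-1 - I) ^ (l * d) * (-1 + I) ^ (l * d) :=
      Dvd.dvd.mul_right h5 _
    rw [mul_assoc, ← mul_pow, show (-1 - I) * (-1 + I) = 2 by linear_combination -hI,
      ← pow_succ'] at h6
    have h7 : ((l : ℤ) : GaussianInt) ∣ ((2 ^ (l * d + 1) : ℤ) : GaussianInt) := by
      push_cast; exact h6
    rw [Zsqrtd.intCast_dvd_intCast] at h7
    have h8 : l ∣ 2 ^ (l * d + 1) := by exact_mod_cast h7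
    exact hl2 ((Nat.prime_dvd_prime_iff_eq hl Nat.prime_two).mp (hl.dvd_of_dvd_pow h8))

theorem exists_emb {K : Type*} [Field K] [CharP K 2] [Fintype K] (l d : ℕ) (hd : d ≠ 0)
    (hK : Fintype.card K = 2 ^ (l * d)) : Nonempty (GaloisField 2 d →+* K) := by
  have : Fact (Nat.Prime 2) := ⟨Nat.prime_two⟩
  let _ : Algebra (ZMod 2) K := ZMod.algebra K 2
  have hf : Module.finrank (ZMod 2) K = l * d := by
    have h1 := Module.card_eq_pow_finrank (K := ZMod 2) (V := K)
    rw [hK, ZMod.card] at h1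
    exact (Nat.pow_right_injective le_rfl h1).symm
  obtain ⟨φ⟩ := FiniteField.nonempty_algHom_of_finrank_dvd (F := ZMod 2) (K := GaloisField 2 d)
    (L := K) (by rw [GaloisField.finrank 2 hd, hf]; exact Dvd.intro_left l rfl)
  exact ⟨φ.toRingHom⟩

theorem gauss_odd_step {K : Type*} [Field K] [CharP K 2] [Fintype K] {I : GaussianInt}
    (hI : I ^ 2 = -1) (n : ℕ) (hn : Odd n) (hK : Fintype.card K = 2 ^ n)
    (ih : ∀ d < n, Odd d → ∀ (L : Type) [Field L] [CharP L 2] [Fintype L],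
      Fintype.card L = 2 ^ d → ∑ x : L, QA I d x = -(-1 - I) ^ d) :
    ∑ x : K, QA I n x = -(-1 - I) ^ n := by
  by_cases h1 : n = 1
  · subst h1
    exact gauss_one hK hI
  · obtain ⟨l, hl, d, rfl⟩ := Nat.exists_prime_and_dvd h1
    have hl2 : l ≠ 2 := by
      rintro rfl
      exact (Nat.not_odd_iff_even.mpr (even_two_mul d)) hn
    have hdo : Odd d := (Nat.odd_mul.mp hn).2
    have hd0 : d ≠ 0 := hdo.pos.ne'
    have : Fact (Nat.Prime 2) := ⟨Nat.prime_two⟩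
    obtain ⟨φ⟩ := exists_emb l d hd0 hK
    have : Fintype (GaloisField 2 d) := Fintype.ofFinite _
    have hL : Fintype.card (GaloisField 2 d) = 2 ^ d := by
      rw [← Nat.card_eq_fintype_card, GaloisField.card 2 d hd0]
    exact gauss_step φ l d hl hl2 hdo hK hL hI
      (ih d (lt_mul_of_one_lt_left hdo.pos hl.one_lt) hdo _ hL)

theorem gauss_odd0 {I : GaussianInt} (hI : I ^ 2 = -1) (n : ℕ) :
    Odd n → ∀ (L : Type) [Field L] [CharP L 2] [Fintype L],
      Fintype.card L = 2 ^ n → ∑ x : L, QA I n x = -(-1 - I) ^ n := by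
  induction n using Nat.strong_induction_on with
  | _ n ih =>
    intro hn L _ _ _ hL
    exact gauss_odd_step hI n hn hL ih

theorem gauss_sum {A K : Type*} [CommRing A] [Field K] [CharP K 2] [Fintype K] {I : A}
    (hI : I ^ 2 = -1) (n : ℕ) (hK : Fintype.card K = 2 ^ n) :
    ∑ x : K, QA I n x = -(-1 - I) ^ n := by
  let i : GaussianInt := ⟨0, 1⟩
  have hi : i ^ 2 = -1 := by
    rw [sq]; rfl
  have h : ∑ x : K, QA i n x = -(-1 - i) ^ n := by
    rcases Nat.even_or_odd n with ⟨r, rfl⟩ | ho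
    · exact gauss_even hi hK
    · exact gauss_odd_step hi n ho hK (fun d _ hd => gauss_odd0 hi d hd)
  let g : GaussianInt →+* A := Zsqrtd.lift ⟨I, by rw [← sq, hI]; simp⟩
  have hg : g i = I := by simp [g, i]
  have h2 := congrArg g h
  rw [map_sum, Finset.sum_congr rfl (fun x _ => ringHom_QA g i x), hg] at h2
  rw [h2]
  simp [hg]

end gauss
section main

theorem rt_pow {L : Type*} [Field L] [ExpChar L 2] [PerfectRing L 2] (j : ℕ) (x : L) :
    (rt L j x) ^ 2 ^ j = x := by
  unfold rt
  induction j generalizing x with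
  | zero => simp
  | succ j ih =>
    rw [Function.iterate_succ_apply', pow_succ', pow_mul]
    rw [frobeniusEquiv_symm_pow_p, ih]

theorem pow_inj2 {L : Type*} [Field L] [CharP L 2] (j : ℕ) {x y : L} (h : x ^ 2 ^ j = y ^ 2 ^ j) :
    x = y := by
  have : (x - y) ^ 2 ^ j = 0 := by
    rw [sub_pow_char_pow, h, sub_self]
  exact sub_eq_zero.mp (pow_eq_zero_iff (by positivity) |>.mp this)

theorem rt_map {L M : Type*} [Field L] [CharP L 2] [PerfectRing L 2] [Field M] [CharP M 2]
    [PerfectRing M 2] (φ : L →+* M) (j : ℕ) (x : L) : rt M j (φ x) = φ (rt L j x) := by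
  apply pow_inj2 j
  rw [rt_pow, ← map_pow, rt_pow]

theorem sum_pairs (N : ℕ) {M : Type*} [AddCommMonoid M] (f : ℕ → ℕ → M) :
    ∑ i ∈ Finset.range N, ∑ j ∈ Finset.Ioo i N, f i j
      = ∑ j ∈ Finset.range N, ∑ i ∈ Finset.range j, f i j := by
  apply Finset.sum_comm'
  intro i j
  simp only [Finset.mem_range, Finset.mem_Ioo]
  omega

theorem sum_pairs' (e : ℕ) {M : Type*} [AddCommMonoid M] (f : ℕ → ℕ → M) :
    ∑ i ∈ Finset.Icc 1 e, ∑ j ∈ Finset.range (e - i + 1), f j (j + i)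
      = ∑ j ∈ Finset.range (e + 1), ∑ i ∈ Finset.range j, f i j := by
  rw [Finset.sum_sigma', Finset.sum_sigma']
  refine Finset.sum_nbij' (fun p => ⟨p.2 + p.1, p.2⟩) (fun p => ⟨p.1 - p.2, p.2⟩) ?_ ?_ ?_ ?_ ?_
  · rintro ⟨i, j⟩ h
    simp only [Finset.mem_sigma, Finset.mem_Icc, Finset.mem_range] at h ⊢
    omega
  · rintro ⟨i, j⟩ h
    simp only [Finset.mem_sigma, Finset.mem_Icc, Finset.mem_range] at h ⊢
    omega
  · rintro ⟨i, j⟩ h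
    simp
  · rintro ⟨i, j⟩ h
    simp only [Finset.mem_sigma, Finset.mem_range] at h
    simp only [Sigma.mk.injEq, heq_eq_eq, and_true]
    omega
  · rintro ⟨i, j⟩ h
    rfl

variable {A K : Type*} [CommRing A] [Field K] [CharP K 2] {n : ℕ} {I : A}

theorem QA_sum (hn : ∀ x : K, x ^ 2 ^ n = x) (hI : I ^ 2 = -1) (y : ℕ → K) (N : ℕ) :
    ∏ i ∈ Finset.range N, QA I n (y i) = QA I n (∑ i ∈ Finset.range N, y i)
      * PA I n (∑ j ∈ Finset.range N, ∑ i ∈ Finset.range j, y i * y j) := by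
  induction N with
  | zero => simp [QA_zero, PA_zero]
  | succ N ih =>
    rw [Finset.prod_range_succ, ih, Finset.sum_range_succ, Finset.sum_range_succ (n := N) (f := fun j => _),
      PA_add hn hI, ← Finset.sum_mul]
    linear_combination PA I n (∑ j ∈ Finset.range N, ∑ i ∈ Finset.range j, y i * y j) *
      QA_mul hn hI (∑ i ∈ Finset.range N, y i) (y N)

variable [PerfectRing K 2]

theorem PA_rt (hn : ∀ x : K, x ^ 2 ^ n = x) (j : ℕ) (c x : K) :
    PA I n (rt K j c * x) = PA I n (c * x ^ 2 ^ j) := by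
  rw [← PA_pow hn j, mul_pow, rt_pow]

theorem QA_rt (hn : ∀ x : K, x ^ 2 ^ n = x) (j : ℕ) (c x : K) :
    QA I n (rt K j c * x) = QA I n (c * x ^ 2 ^ j) := by
  rw [← QA_pow hn j, mul_pow, rt_pow]

theorem PA_adj (hn : ∀ x : K, x ^ 2 ^ n = x) (hI : I ^ 2 = -1) (k e : ℕ) (b : ℕ → K) (t x : K) :
    PA I n (adj k e b t * x) = PA I n (t * Lpoly (2 ^ k) e b x) := by
  unfold adj Lpoly
  rw [Finset.sum_mul, Finset.mul_sum, PA_sum hn hI, PA_sum hn hI]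
  refine Finset.prod_congr rfl fun i _ => ?_
  rw [PA_rt hn, ← pow_mul]
  congr 1
  ring

theorem PA_RF (hn : ∀ x : K, x ^ 2 ^ n = x) (hI : I ^ 2 = -1) (k e : ℕ) (b : ℕ → K) (x : K) :
    PA I n (x * RF k e b x) = PA I n (∑ j ∈ Finset.range (e + 1), ∑ i ∈ Finset.range j,
      (b i * x ^ (2 ^ k) ^ i) * (b j * x ^ (2 ^ k) ^ j)) := by
  rw [← sum_pairs' e (fun i j => (b i * x ^ (2 ^ k) ^ i) * (b j * x ^ (2 ^ k) ^ j))]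
  unfold RF aRF
  rw [Finset.mul_sum, PA_sum hn hI, PA_sum hn hI]
  refine Finset.prod_congr rfl fun i _ => ?_
  rw [Finset.sum_mul, Finset.mul_sum, PA_sum hn hI, PA_sum hn hI]
  refine Finset.prod_congr rfl fun j _ => ?_
  rw [show ∀ r s : K, x * (r * s) = r * (x * s) from fun r s => by ring, PA_rt hn]
  congr 1
  rw [mul_pow, ← pow_mul, ← pow_mul, ← pow_mul, ← pow_mul]
  ring

theorem QA_F (hn : ∀ x : K, x ^ 2 ^ n = x) (hI : I ^ 2 = -1) (k e : ℕ) (b : ℕ → K)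
    (hb : adj k e b 1 = 0) (x : K) :
    QA I n (Lpoly (2 ^ k) e b x) = PA I n (x * RF k e b x + gammaF k e b * x ^ 2) := by
  have h1 := QA_sum hn hI (fun i => b i * x ^ (2 ^ k) ^ i) (e + 1)
  have h2 := QA_sum hn hI (fun i => rt K (k * i) (b i) * x) (e + 1)
  rw [← PA_RF hn hI] at h1
  have h3 : ∑ i ∈ Finset.range (e + 1), rt K (k * i) (b i) * x = 0 := by
    rw [← Finset.sum_mul]
    unfold adj at hb
    simp only [mul_one] at hb
    rw [hb, zero_mul]
  have h4 : ∑ j ∈ Finset.range (e + 1), ∑ i ∈ Finset.range j,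
      (rt K (k * i) (b i) * x) * (rt K (k * j) (b j) * x) = gammaF k e b * x ^ 2 := by
    unfold gammaF
    rw [sum_pairs, Finset.sum_mul]
    refine Finset.sum_congr rfl fun j _ => ?_
    rw [Finset.sum_mul]
    refine Finset.sum_congr rfl fun i _ => ?_
    ring
  rw [h3, h4, QA_zero, one_mul] at h2
  have h5 : ∏ i ∈ Finset.range (e + 1), QA I n (rt K (k * i) (b i) * x)
      = ∏ i ∈ Finset.range (e + 1), QA I n (b i * x ^ (2 ^ k) ^ i) := by
    refine Finset.prod_congr rfl fun i _ => ?_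
    rw [QA_rt hn, pow_mul]
  rw [h5, h1] at h2
  rw [PA_add hn hI, ← h2]
  change QA I n (∑ i ∈ Finset.range (e + 1), b i * x ^ (2 ^ k) ^ i) = _
  linear_combination -(QA I n (∑ i ∈ Finset.range (e + 1), b i * x ^ (2 ^ k) ^ i)) *
    PA_mul_self hn hI (x * RF k e b x)

theorem PA_RFt (hn : ∀ x : K, x ^ 2 ^ n = x) (hI : I ^ 2 = -1) (k e : ℕ) (b : ℕ → K)
    (hb : adj k e b 1 = 0) (t x : K) :
    PA I n (x * RFt k e b t x)
      = QA I n (Lpoly (2 ^ k) e b x) * PA I n (t * Lpoly (2 ^ k) e b x) := by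
  rw [QA_F hn hI k e b hb, ← PA_adj hn hI, ← PA_sq hn (adj k e b t * x), ← PA_add hn hI]
  congr 1
  unfold RFt alphaF
  ring

theorem sum_fiber [Fintype K] [IsDomain A] [CharZero A] (hI : I ^ 2 = -1)
    (hcard : Fintype.card K = 2 ^ n) (k e : ℕ) (b : ℕ → K) (f : K → A) :
    ∑ x : K, f (Lpoly (2 ^ k) e b x)
      = ∑ v ∈ Finset.univ.filter (fun v : K => adj k e b v = 0), ∑ y : K, f y * PA I n (v * y) := by
  have hn := pow_q hcard
  apply mul_left_cancel₀ (pow_ne_zero n (two_ne_zero (α := A)))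
  have h1 : ∀ x : K, (2 : A) ^ n * f (Lpoly (2 ^ k) e b x)
      = ∑ y : K, ∑ z : K, f y * PA I n (z * y) * PA I n (adj k e b z * x) := by
    intro x
    have : ∀ y z : K, f y * PA I n (z * y) * PA I n (adj k e b z * x)
        = f y * PA I n ((y + Lpoly (2 ^ k) e b x) * z) := by
      intro y z
      rw [PA_adj hn hI, mul_assoc, ← PA_add hn hI]
      congr 2
      ring
    simp only [this, ← Finset.mul_sum, sum_PA hI hcard, mul_ite, mul_zero, CharTwo.add_eq_zero]
    rw [Finset.sum_ite_eq', if_pos (Finset.mem_univ _), mul_comm]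
  rw [Finset.mul_sum, Finset.sum_congr rfl (fun x _ => h1 x), Finset.sum_comm]
  simp_rw [Finset.sum_comm (s := (Finset.univ : Finset K)) (t := (Finset.univ : Finset K))
    (f := fun x z => f _ * PA I n (z * _) * PA I n (adj k e b z * x))]
  simp only [← Finset.mul_sum, sum_PA hI hcard, mul_ite, mul_zero]
  rw [Finset.sum_comm, Finset.sum_filter, Finset.mul_sum]
  refine Finset.sum_congr rfl fun v _ => ?_
  by_cases hv : adj k e b v = 0
  · simp only [hv, if_true, ← Finset.sum_mul]
    rw [mul_comm]
  · simp [hv]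

end main

theorem main_id {K : Type*} [Field K] [Fintype K] [CharP K 2] (n k e : ℕ)
    (hcard : Fintype.card K = 2 ^ n) (b : ℕ → K) (hb : adj k e b 1 = 0)
    (I : ℂ) (hI : I ^ 2 = -1) (t : K) :
    ∑ x : K, PA I n (x * RFt k e b t x)
      = -(-1 - I) ^ n * ∑ v ∈ Finset.univ.filter (fun v : K => adj k e b v = 0),
            (QA I n (t + v))⁻¹ := by
  have hn := pow_q hcard
  rw [Finset.sum_congr rfl (fun x _ => PA_RFt hn hI k e b hb t x)]
  rw [sum_fiber hI hcard k e b (fun y => QA I n y * PA I n (t * y)), ← gauss_sum hI n hcard,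
    Finset.mul_sum]
  refine Finset.sum_congr rfl fun v _ => ?_
  have hq : QA I n (t + v) ≠ 0 := by
    intro h
    have h1 := QA_mul_self hn hI (t + v)
    have h2 := PA_mul_self hn hI (t + v)
    rw [← h1, h] at h2
    simp at h2
  rw [eq_mul_inv_iff_mul_eq₀ hq, Finset.sum_mul,
    ← Equiv.sum_comp (Equiv.addRight (t + v)) (fun y => QA I n y)]
  refine Finset.sum_congr rfl fun y _ => ?_
  rw [Equiv.coe_addRight, mul_assoc (QA I n y), ← PA_add hn hI,
    show t * y + v * y = y * (t + v) by ring]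
  linear_combination PA I n (y * (t + v)) * QA_mul hn hI y (t + v)
    + QA I n (y + (t + v)) * PA_mul_self hn hI (y * (t + v))

end helpers

/-- Under conditions (i)-(iii) on `F`, for every `t ∈ 𝔽_q`,
`∑_{x ∈ 𝔽_q} ψ_q(x R_{F,t}(x)) = -(-1-√-1)^{[𝔽_q:𝔽_2]} ∑_{v ∈ W_F^*} Q_q(t+v)⁻¹`. -/
theorem statement1 {K : Type*} [Field K] [Fintype K] [CharP K 2]
    (k m e : ℕ) (hk : 1 ≤ k) (hm : 1 ≤ m) (he : 1 ≤ e)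
    (hcard : Fintype.card K = 2 ^ (k * m))
    (b : ℕ → K)
    (hb1 : b 0 * b e ≠ 0)
    (hb2 : adjBar k e b 1 = 0)
    (hb3 : ∀ x : AlgebraicClosure K, adjBar k e b x = 0 →
      x ∈ Set.range (algebraMap K (AlgebraicClosure K)))
    (I : ℂ) (hI : I ^ 2 = -1) (t : K) :
    ∑ x : K, psiq (k * m) (x * RFt k e b t x)
      = -(-1 - I) ^ (k * m) *
          ∑ v ∈ Finset.univ.filter
              (fun v : K => adjBar k e b (algebraMap K (AlgebraicClosure K) v) = 0),
            (Qq I (k * m) (t + v))⁻¹ := by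
  have hbar : ∀ v : K, adjBar k e b (algebraMap K (AlgebraicClosure K) v)
      = algebraMap K (AlgebraicClosure K) (adj k e b v) := by
    intro v
    unfold adjBar adj
    rw [map_sum]
    refine Finset.sum_congr rfl fun i _ => ?_
    rw [← map_mul, rt_map]
  have hz : ∀ v : K, adjBar k e b (algebraMap K (AlgebraicClosure K) v) = 0
      ↔ adj k e b v = 0 := by
    intro v
    rw [hbar, map_eq_zero_iff _ (algebraMap K (AlgebraicClosure K)).injective]
  have hb : adj k e b 1 = 0 := by
    rw [← hz, map_one]
    exact hb2
  have h := main_id (k * m) k e hcard b hb I hI t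
  have hP : ∀ x : K, psiq (k * m) x = PA I (k * m) x := by
    intro x
    rw [PA_eq]
    rfl
  have hQ : ∀ x : K, Qq I (k * m) x = QA I (k * m) x := fun x => rfl
  simp only [hP, hQ, hz]
  exact h

end
end

section
/- Assume F satisfies conditions (i)–(iv), and set R := R_F; then n := [F_q:F_2] is even. Define S_F := {t ∈ F_q : Q_q(v) = ψ_q(tv) for all v ∈ W_F*}, S_{F,−} := {t ∈ S_F : Q_q(t) = −(√−1)^{n/2}}, S_{F,+} := {t ∈ S_F : Q_q(t) = (√−1)^{n/2}}, S_0 := F_q ∖ S_F. For a ∈ F_q let N(a) := |{(x,y) ∈ F_q × F_q : y^p − y = x(R(x) + a x)}|, and set T_{R,0} := {a : N(a) = q}, T_{R,max} := {a : N(a) = q + (p−1)p^e·2^{n/2}}, T_{R,min} := {a : N(a) = q − (p−1)p^e·2^{n/2}}. Then: (1) F_q is the disjoint union S_0 ⊔ S_{F,−} ⊔ S_{F,+}; (2) α_F(S_0) ⊆ T_{R,0}, α_F(S_{F,−}) = T_{R,max}, and α_F(S_{F,+}) = T_{R,min}. -/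
open Finset

open scoped Classical

noncomputable section

variable {K : Type*}

/-- The set `S_F = {t ∈ 𝔽_q ∣ Q_q(v) = ψ_q(tv) for all v ∈ W_F^*}`. -/
def SF (K : Type*) [Field K] [Fintype K] [CharP K 2] (I : ℂ) (k m e : ℕ) (b : ℕ → K) :
    Set K :=
  {t : K | ∀ v : K, adjBar k e b (algebraMap K (AlgebraicClosure K) v) = 0 →
    Qq I (k * m) v = psiq (k * m) (t * v)}

/-- The set `S_{F,-} = {t ∈ S_F ∣ Q_q(t) = -(√-1)^{n/2}}`. -/
def SFminus (K : Type*) [Field K] [Fintype K] [CharP K 2] (I : ℂ) (k m e : ℕ) (b : ℕ → K) :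
    Set K :=
  {t ∈ SF K I k m e b | Qq I (k * m) t = -I ^ ((k * m) / 2)}

/-- The set `S_{F,+} = {t ∈ S_F ∣ Q_q(t) = (√-1)^{n/2}}`. -/
def SFplus (K : Type*) [Field K] [Fintype K] [CharP K 2] (I : ℂ) (k m e : ℕ) (b : ℕ → K) :
    Set K :=
  {t ∈ SF K I k m e b | Qq I (k * m) t = I ^ ((k * m) / 2)}

/-- The set `S_0 = 𝔽_q ∖ S_F`. -/
def S0 (K : Type*) [Field K] [Fintype K] [CharP K 2] (I : ℂ) (k m e : ℕ) (b : ℕ → K) :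
    Set K :=
  (SF K I k m e b)ᶜ

/-- `T_{R,0}`: the set of `a` with `|C_a(𝔽_q)| = q`, for `R = R_F`. -/
def TR0 (K : Type*) [Field K] [Fintype K] [CharP K 2] (k m e : ℕ) (b : ℕ → K) : Set K :=
  {a : K | (Ncount K (2 ^ k) (fun x => RF k e b x + a * x) : ℤ) = 2 ^ (k * m)}

/-- `T_{R,max}`: the set of `a` with `|C_a(𝔽_q)| = q + (p-1)pᵉ√q`, for `R = R_F`. -/
def TRmax (K : Type*) [Field K] [Fintype K] [CharP K 2] (k m e : ℕ) (b : ℕ → K) : Set K :=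
  {a : K | (Ncount K (2 ^ k) (fun x => RF k e b x + a * x) : ℤ)
      = 2 ^ (k * m) + (2 ^ k - 1) * (2 ^ k) ^ e * 2 ^ ((k * m) / 2)}

/-- `T_{R,min}`: the set of `a` with `|C_a(𝔽_q)| = q - (p-1)pᵉ√q`, for `R = R_F`. -/
def TRmin (K : Type*) [Field K] [Fintype K] [CharP K 2] (k m e : ℕ) (b : ℕ → K) : Set K :=
  {a : K | (Ncount K (2 ^ k) (fun x => RF k e b x + a * x) : ℤ)
      = 2 ^ (k * m) - (2 ^ k - 1) * (2 ^ k) ^ e * 2 ^ ((k * m) / 2)}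


section helpers

set_option linter.unusedSectionVars false

theorem sf_one_ne_neg : (1 : ℂ) ≠ -1 := by norm_num

variable [Field K] [CharP K 2]

theorem sf_add_pow (x y : K) (i : ℕ) : (x + y) ^ 2 ^ i = x ^ 2 ^ i + y ^ 2 ^ i :=
  add_pow_char_pow x y 2 i

theorem sf_sum_pow {ι : Type*} (s : Finset ι) (f : ι → K) (i : ℕ) :
    (∑ j ∈ s, f j) ^ 2 ^ i = ∑ j ∈ s, f j ^ 2 ^ i := by
  exact sum_pow_char_pow 2 i s f

theorem sf_tr2_add (n : ℕ) (x y : K) : tr2 n (x + y) = tr2 n x + tr2 n y := by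
  simp only [tr2, sf_add_pow, Finset.sum_add_distrib]

theorem sf_tr2_zero (n : ℕ) : tr2 n (0 : K) = 0 := by
  simp [tr2]

theorem sf_tr2_sum {ι : Type*} (n : ℕ) (s : Finset ι) (f : ι → K) :
    tr2 n (∑ j ∈ s, f j) = ∑ j ∈ s, tr2 n (f j) := by
  induction s using Finset.induction_on with
  | empty => simp [sf_tr2_zero]
  | insert a s ha ih => rw [Finset.sum_insert ha, Finset.sum_insert ha, sf_tr2_add, ih]

theorem sf_pow_card [Fintype K] {n : ℕ} (hn : Fintype.card K = 2 ^ n) (x : K) : x ^ 2 ^ n = x := by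
  rw [← hn]; exact FiniteField.pow_card x

theorem sf_sum_shift {A : Type*} [AddCommMonoid A] (n : ℕ) (f : ℕ → A) (h : f n = f 0) :
    ∑ i ∈ Finset.range n, f (i + 1) = ∑ i ∈ Finset.range n, f i := by
  cases n with
  | zero => simp
  | succ n => rw [Finset.sum_range_succ, h, ← Finset.sum_range_succ']

theorem sf_tr2_sq [Fintype K] {n : ℕ} (hn : Fintype.card K = 2 ^ n) (x : K) :
    tr2 n (x ^ 2) = tr2 n x := by
  have := sf_sum_shift n (fun i => x ^ 2 ^ i) (by simp [sf_pow_card hn])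
  simp only [tr2]
  rw [← this]
  refine Finset.sum_congr rfl fun i _ => ?_
  rw [← pow_mul, pow_succ']

theorem sf_tr2_pow [Fintype K] {n : ℕ} (hn : Fintype.card K = 2 ^ n) (x : K) (j : ℕ) :
    tr2 n (x ^ 2 ^ j) = tr2 n x := by
  induction j with
  | zero => simp
  | succ j ih => rw [pow_succ, pow_mul, sf_tr2_sq hn, ih]

theorem sf_zero_or_one {x : K} (h : x ^ 2 = x) : x = 0 ∨ x = 1 := by
  have : x * (x - 1) = 0 := by ring_nf; rw [h]; ring
  rcases mul_eq_zero.1 this with h | h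
  · exact Or.inl h
  · exact Or.inr (sub_eq_zero.1 h)

theorem sf_tr2_mem [Fintype K] {n : ℕ} (hn : Fintype.card K = 2 ^ n) (x : K) :
    tr2 n x = 0 ∨ tr2 n x = 1 := by
  apply sf_zero_or_one
  conv_rhs => rw [← sf_tr2_sq hn]
  have := sf_sum_pow (Finset.range n) (fun i => x ^ 2 ^ i) 1
  simp only [pow_one] at this
  simp only [tr2, this]
  refine Finset.sum_congr rfl fun i _ => ?_
  rw [← pow_mul, ← pow_mul, mul_comm]

theorem sf_psi_add [Fintype K] {n : ℕ} (hn : Fintype.card K = 2 ^ n) (x y : K) :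
    psiq n (x + y) = psiq n x * psiq n y := by
  simp only [psiq, sf_tr2_add]
  rcases sf_tr2_mem hn x with h | h <;> rcases sf_tr2_mem hn y with h' | h' <;>
    simp [h, h', CharTwo.add_self_eq_zero]

theorem sf_psi_zero (n : ℕ) : psiq n (0 : K) = 1 := by simp [psiq, sf_tr2_zero]

theorem sf_psi_pm (n : ℕ) (x : K) : psiq n x = 1 ∨ psiq n x = -1 := by
  unfold psiq; split_ifs <;> simp

theorem sf_psi_congr {n : ℕ} {x y : K} (h : tr2 n x = tr2 n y) : psiq n x = psiq n y := by
  simp [psiq, h]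

theorem sf_psi_nontriv [Fintype K] {n : ℕ} (hn : Fintype.card K = 2 ^ n) :
    ∃ x : K, psiq n x = -1 := by
  let _ : Algebra (ZMod 2) K := ZMod.algebra K 2
  obtain ⟨b, hb⟩ := Algebra.trace_surjective (ZMod 2) K 1
  refine ⟨b, ?_⟩
  have h1 := FiniteField.algebraMap_trace_eq_sum_pow (ZMod 2) K b
  have hr : Module.finrank (ZMod 2) K = n := by
    have := Module.card_eq_pow_finrank (K := ZMod 2) (V := K)
    rw [hn, ZMod.card] at this
    exact (Nat.pow_right_injective le_rfl this).symm
  rw [hr, Nat.card_zmod] at h1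
  have : tr2 n b ≠ 0 := by
    unfold tr2
    rw [← h1, hb, map_one]
    exact one_ne_zero
  simp [psiq, this]

/-- Orthogonality. -/
theorem sf_orth [Fintype K] {n : ℕ} (hn : Fintype.card K = 2 ^ n) (z : K) :
    ∑ x : K, psiq n (z * x) = if z = 0 then (2 : ℂ) ^ n else 0 := by
  split_ifs with h
  · subst h
    simp [sf_psi_zero, hn]
  · obtain ⟨y, hy⟩ := sf_psi_nontriv hn (K := K)
    have h1 : ∑ x : K, psiq n (z * x) = ∑ x : K, psiq n (z * (x + z⁻¹ * y)) :=
      (Equiv.sum_comp (Equiv.addRight (z⁻¹ * y)) (fun x => psiq n (z * x))).symm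
    have h2 : ∀ x : K, psiq n (z * (x + z⁻¹ * y)) = - psiq n (z * x) := by
      intro x
      rw [mul_add, mul_inv_cancel_left₀ h, sf_psi_add hn, hy]; ring
    simp only [h2, Finset.sum_neg_distrib] at h1
    exact self_eq_neg.1 h1

/-- Counting fibres of a map with an adjoint. -/
theorem sf_fibre [Fintype K] {n : ℕ} (hn : Fintype.card K = 2 ^ n) (f g : K → K)
    (hfg : ∀ x z, psiq n (f x * z) = psiq n (x * g z)) (u : K) :
    ((#{x : K | f x = u} : ℕ) : ℂ) = ∑ z : K with g z = 0, psiq n (z * u) := by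
  have hq : (2 : ℂ) ^ n ≠ 0 := pow_ne_zero _ two_ne_zero
  have h1 : ∑ x : K, ∑ z : K, psiq n ((u + f x) * z) = (2 : ℂ) ^ n * #{x : K | f x = u} := by
    simp only [sf_orth hn, CharTwo.add_eq_zero]
    rw [← Finset.sum_filter, Finset.sum_const, nsmul_eq_mul, mul_comm]
    congr 4
    ext x; exact eq_comm
  have h2 : ∑ x : K, ∑ z : K, psiq n ((u + f x) * z)
      = (2 : ℂ) ^ n * ∑ z : K with g z = 0, psiq n (z * u) := by
    rw [Finset.sum_comm, Finset.sum_filter, Finset.mul_sum]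
    refine Finset.sum_congr rfl fun z _ => ?_
    simp only [add_mul, sf_psi_add hn, hfg]
    rw [← Finset.mul_sum]
    simp only [mul_comm _ (g z), sf_orth hn]
    split_ifs <;> simp [mul_comm]
  exact mul_left_cancel₀ hq (h1.symm.trans h2)

/-- Summation along a map with an adjoint. -/
theorem sf_fibre_sum [Fintype K] {n : ℕ} (hn : Fintype.card K = 2 ^ n) (f g : K → K)
    (hfg : ∀ x z, psiq n (f x * z) = psiq n (x * g z)) (G : K → ℂ) :
    ∑ x : K, G (f x) = ∑ z : K with g z = 0, ∑ u : K, G u * psiq n (z * u) := by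
  rw [Finset.sum_comm]
  rw [← Finset.sum_fiberwise (s := Finset.univ) (g := f)]
  refine Finset.sum_congr rfl fun u _ => ?_
  rw [← Finset.mul_sum, ← sf_fibre hn f g hfg u]
  rw [Finset.sum_congr rfl (g := fun _ => G u) (fun x hx => by rw [(Finset.mem_filter.1 hx).2])]
  rw [Finset.sum_const, nsmul_eq_mul, mul_comm]

end helpers

section helpersW

set_option linter.unusedSectionVars false

variable [Field K] [CharP K 2]

/-- Constructor for length-two Witt vectors. -/
def sfMk (x y : K) : W2 K := ((x, y) : K × K)

theorem sfMk_fst (x y : K) : (sfMk x y).1 = x := rfl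
theorem sfMk_snd (x y : K) : (sfMk x y).2 = y := rfl
theorem sf_Qq_eq (I : ℂ) (n : ℕ) (x : K) : Qq I n x = W2.xi I (W2.tr n (sfMk x 0)) := rfl

theorem sf_tr_zero (x : W2 K) : W2.tr 0 x = 0 := by simp [W2.tr]
theorem sf_tr_succ (n : ℕ) (x : W2 K) : W2.tr (n + 1) x = W2.tr n x + W2.frob^[n] x := by
  simp [W2.tr, Finset.sum_range_succ]

theorem sf_w_ext {x y : W2 K} (h1 : x.1 = y.1) (h2 : x.2 = y.2) : x = y := Prod.ext h1 h2

theorem sf_frob_fst (x : W2 K) : (W2.frob x).1 = x.1 ^ 2 := rfl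
theorem sf_frob_snd (x : W2 K) : (W2.frob x).2 = x.2 ^ 2 := rfl

theorem sf_frob_add (x y : W2 K) : W2.frob (x + y) = W2.frob x + W2.frob y := by
  apply sf_w_ext
  · simp only [sf_frob_fst, W2.fst_add]; exact add_pow_char x.1 y.1 2
  · simp only [sf_frob_snd, sf_frob_fst, W2.snd_add]
    have := add_pow_char (x.2 + y.2) (x.1 * y.1) 2
    have h2 := add_pow_char x.2 y.2 2
    rw [this, h2, mul_pow]

theorem sf_frob_zero : W2.frob (0 : W2 K) = 0 := by
  apply sf_w_ext <;> simp [sf_frob_fst, sf_frob_snd, W2.fst_zero, W2.snd_zero]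

theorem sf_frob_it_add (i : ℕ) (x y : W2 K) :
    W2.frob^[i] (x + y) = W2.frob^[i] x + W2.frob^[i] y := by
  induction i with
  | zero => rfl
  | succ i ih => simp only [Function.iterate_succ', Function.comp, ih, sf_frob_add]

theorem sf_frob_it_fst (i : ℕ) (x : W2 K) : (W2.frob^[i] x).1 = x.1 ^ 2 ^ i := by
  induction i with
  | zero => simp
  | succ i ih => simp only [Function.iterate_succ', Function.comp, sf_frob_fst, ih, pow_succ, pow_mul]

theorem sf_frob_it_snd (i : ℕ) (x : W2 K) : (W2.frob^[i] x).2 = x.2 ^ 2 ^ i := by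
  induction i with
  | zero => simp
  | succ i ih => simp only [Function.iterate_succ', Function.comp, sf_frob_snd, ih, pow_succ, pow_mul]

theorem sf_tr_add (n : ℕ) (x y : W2 K) : W2.tr n (x + y) = W2.tr n x + W2.tr n y := by
  simp only [W2.tr, sf_frob_it_add, Finset.sum_add_distrib]

theorem sf_frob_sum {ι : Type*} (s : Finset ι) (f : ι → W2 K) :
    W2.frob (∑ i ∈ s, f i) = ∑ i ∈ s, W2.frob (f i) := by
  induction s using Finset.induction_on with
  | empty => simp [sf_frob_zero]
  | insert a s ha ih => rw [Finset.sum_insert ha, Finset.sum_insert ha, sf_frob_add, ih]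

theorem sf_frob_card [Fintype K] {n : ℕ} (hn : Fintype.card K = 2 ^ n) (x : W2 K) :
    W2.frob^[n] x = x := by
  apply sf_w_ext
  · rw [sf_frob_it_fst, sf_pow_card hn]
  · rw [sf_frob_it_snd, sf_pow_card hn]

theorem sf_tr_frob [Fintype K] {n : ℕ} (hn : Fintype.card K = 2 ^ n) (x : W2 K) :
    W2.tr n (W2.frob x) = W2.tr n x := by
  have := sf_sum_shift n (fun i => W2.frob^[i] x) (by simp [sf_frob_card hn])
  simpa only [W2.tr, Function.iterate_succ, Function.comp] using this

theorem sf_frob_tr [Fintype K] {n : ℕ} (hn : Fintype.card K = 2 ^ n) (x : W2 K) :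
    W2.frob (W2.tr n x) = W2.tr n x := by
  conv_rhs => rw [← sf_tr_frob hn]
  simp only [W2.tr, sf_frob_sum]
  refine Finset.sum_congr rfl fun i _ => ?_
  rw [← Function.iterate_succ_apply' W2.frob, ← Function.iterate_succ_apply W2.frob]

theorem sf_tr_mem [Fintype K] {n : ℕ} (hn : Fintype.card K = 2 ^ n) (x : W2 K) :
    ((W2.tr n x).1 = 0 ∨ (W2.tr n x).1 = 1) ∧ ((W2.tr n x).2 = 0 ∨ (W2.tr n x).2 = 1) := by
  have h := sf_frob_tr hn x
  constructor
  · apply sf_zero_or_one; rw [← sf_frob_fst, h]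
  · apply sf_zero_or_one; rw [← sf_frob_snd, h]

/-- Witt vectors over the prime field. -/
def sfPrim (x : W2 K) : Prop := (x.1 = 0 ∨ x.1 = 1) ∧ (x.2 = 0 ∨ x.2 = 1)

theorem sf_xi_add {I : ℂ} (hI : I ^ 2 = -1) {x y : W2 K} (hx : sfPrim x) (hy : sfPrim y) :
    W2.xi I (x + y) = W2.xi I x * W2.xi I y := by
  have hI' : I * I = -1 := by rw [← hI]; ring
  obtain ⟨h1, h2⟩ := hx
  obtain ⟨h3, h4⟩ := hy
  simp only [W2.xi, W2.fst_add, W2.snd_add]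
  rcases h1 with h1 | h1 <;> rcases h2 with h2 | h2 <;> rcases h3 with h3 | h3 <;>
    rcases h4 with h4 | h4 <;> simp [h1, h2, h3, h4, CharTwo.add_self_eq_zero, hI']

theorem sf_tr_snd (n : ℕ) (w : K) : W2.tr n (sfMk (0) (w)) = sfMk (0) (tr2 n w) := by
  induction n with
  | zero => simp [sf_tr_zero, tr2]; rfl
  | succ n ih =>
    rw [sf_tr_succ, ih]
    apply sf_w_ext
    · rw [W2.fst_add, sf_frob_it_fst]; simp [sfMk_fst]
    · rw [W2.snd_add, sf_frob_it_fst, sf_frob_it_snd]; simp [tr2, Finset.sum_range_succ, sfMk_fst, sfMk_snd]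

theorem sf_tr_fst (n : ℕ) (x : W2 K) : (W2.tr n x).1 = tr2 n x.1 := by
  induction n with
  | zero => simp [sf_tr_zero, tr2]; rfl
  | succ n ih =>
    rw [sf_tr_succ, W2.fst_add, ih, sf_frob_it_fst]
    simp [tr2, Finset.sum_range_succ, sfMk_fst, sfMk_snd]

theorem sf_Q_add [Fintype K] {n : ℕ} (hn : Fintype.card K = 2 ^ n) {I : ℂ} (hI : I ^ 2 = -1)
    (x y : K) : Qq I n (x + y) = Qq I n x * Qq I n y * psiq n (x * y) := by
  have e : (sfMk (x + y) (0)) + (sfMk (0) (x * y))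
      = (sfMk (x) (0)) + (sfMk (y) (0)) := by
    apply sf_w_ext
    · simp [W2.fst_add, sfMk_fst]
    · simp [W2.snd_add, sfMk_fst, sfMk_snd]
  have h := congrArg (fun z => W2.xi I (W2.tr n z)) e
  simp only [sf_tr_add] at h
  rw [sf_xi_add hI (sf_tr_mem hn _) (sf_tr_mem hn _),
    sf_xi_add hI (sf_tr_mem hn _) (sf_tr_mem hn _), sf_tr_snd] at h
  have h2 : W2.xi I (sfMk (0) (tr2 n (x * y))) = psiq n (x * y) := by
    unfold W2.xi psiq
    rw [sfMk_fst, sfMk_snd, if_pos rfl, one_mul]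
  rw [h2] at h
  have hs : psiq n (x * y) * psiq n (x * y) = 1 := by
    rcases sf_psi_pm n (x * y) with h | h <;> rw [h] <;> norm_num
  simp only [sf_Qq_eq]
  rw [← h, mul_assoc, hs, mul_one]

theorem sf_Q_zero (I : ℂ) (n : ℕ) : Qq I n (0 : K) = 1 := by
  simp only [sf_Qq_eq]
  rw [sf_tr_snd, sf_tr2_zero]
  simp [W2.xi, sfMk_fst, sfMk_snd]

theorem sf_Q_sq [Fintype K] {n : ℕ} (hn : Fintype.card K = 2 ^ n) {I : ℂ} (hI : I ^ 2 = -1)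
    (x : K) : Qq I n x ^ 2 = psiq n x := by
  have h := sf_Q_add hn hI x x
  rw [CharTwo.add_self_eq_zero, sf_Q_zero, ← sq x, sf_psi_congr (sf_tr2_sq hn x)] at h
  rcases sf_psi_pm n x with h' | h' <;> rw [h'] at h ⊢
  · linear_combination -h
  · linear_combination h

theorem sf_Q_ne [Fintype K] {n : ℕ} (hn : Fintype.card K = 2 ^ n) {I : ℂ} (hI : I ^ 2 = -1)
    (x : K) : Qq I n x ≠ 0 := by
  intro h
  have := sf_Q_sq hn hI x
  rw [h] at this
  rcases sf_psi_pm n x with h' | h' <;> rw [h'] at this <;> norm_num at this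

theorem sf_Q_pow [Fintype K] {n : ℕ} (hn : Fintype.card K = 2 ^ n) (I : ℂ)
    (x : K) (j : ℕ) : Qq I n (x ^ 2 ^ j) = Qq I n x := by
  induction j with
  | zero => simp
  | succ j ih =>
    rw [← ih]
    simp only [sf_Qq_eq]
    rw [← sf_tr_frob hn (sfMk (x ^ 2 ^ j) (0))]
    congr 2
    apply sf_w_ext
    · rw [sf_frob_fst]; simp only [sfMk_fst]; rw [← pow_mul, pow_succ]
    · rw [sf_frob_snd]; simp [sfMk_snd]

/-- An auxiliary sum of `(1, c ^ 2 ^ i)`. -/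
theorem sf_xi_sum {I : ℂ} (hI : I ^ 2 = -1)
    (h : ℕ) (c : K) (hc : tr2 h c = 0 ∨ tr2 h c = 1) :
    W2.xi I (W2.tr h (sfMk (1 : K) c)) = I ^ h * psiq h c := by
  have e : (sfMk (1 : K) c) = (sfMk (1 : K) (0 : K)) + (sfMk (0) (c)) := by
    apply sf_w_ext <;> simp [W2.fst_add, W2.snd_add, sfMk_fst, sfMk_snd]
  have h1 : sfPrim (W2.tr h (sfMk (1 : K) (0 : K))) ∧
      W2.xi I (W2.tr h (sfMk (1 : K) (0 : K))) = I ^ h := by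
    clear hc e
    induction h with
    | zero =>
      have : W2.tr 0 (sfMk (1 : K) (0 : K)) = sfMk (0) (0) := sf_tr_zero _
      rw [this]; simp [sfPrim, W2.xi, sfMk_fst, sfMk_snd]
    | succ h ih =>
      have h3 : W2.frob^[h] (sfMk (1 : K) (0 : K)) = sfMk (1 : K) (0 : K) := by
        apply sf_w_ext
        · rw [sf_frob_it_fst]; simp [sfMk_fst]
        · rw [sf_frob_it_snd]; simp [sfMk_snd]
      have h2 : W2.tr (h + 1) (sfMk (1 : K) (0 : K))
          = W2.tr h (sfMk (1 : K) (0 : K)) + (sfMk (1 : K) (0 : K)) := by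
        conv_lhs => rw [sf_tr_succ, h3]
      have h4 : sfPrim (sfMk (1 : K) (0 : K)) := by simp [sfPrim, sfMk_fst, sfMk_snd]
      constructor
      · rw [h2]
        obtain ⟨⟨a, b⟩, _⟩ := ih
        simp only [sfPrim, W2.fst_add, W2.snd_add, sfMk_fst, sfMk_snd]
        rcases a with a | a <;> rcases b with b | b <;> simp [a, b, CharTwo.add_self_eq_zero]
      · rw [h2, sf_xi_add hI ih.1 h4, ih.2, pow_succ]
        simp [W2.xi, sfMk_fst, sfMk_snd]
  rw [e, sf_tr_add, sf_tr_snd, sf_xi_add hI h1.1, h1.2]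
  · congr 1
    unfold W2.xi psiq
    rw [sfMk_fst, sfMk_snd, if_pos rfl, one_mul]
  · simpa [sfPrim, sfMk_fst, sfMk_snd] using hc

theorem sf_Q_one [Fintype K] {n : ℕ} (hn : Fintype.card K = 2 ^ n) {I : ℂ} (hI : I ^ 2 = -1) :
    Qq I n (1 : K) = I ^ n := by
  have := sf_xi_sum hI n (0 : K) (Or.inl (sf_tr2_zero n))
  rw [sf_psi_zero, mul_one] at this
  exact this

/-- `∑ Q(u) ψ(su) = G / Q(s)`. -/
theorem sf_gauss_twist [Fintype K] {n : ℕ} (hn : Fintype.card K = 2 ^ n) {I : ℂ} (hI : I ^ 2 = -1)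
    (s : K) : ∑ u : K, Qq I n u * psiq n (s * u) = (∑ u : K, Qq I n u) * (Qq I n s)⁻¹ := by
  rw [eq_mul_inv_iff_mul_eq₀ (sf_Q_ne hn hI s), Finset.sum_mul]
  rw [← Equiv.sum_comp (Equiv.addRight s) (fun x => Qq I n x)]
  refine Finset.sum_congr rfl fun u _ => ?_
  simp only [Equiv.coe_addRight]
  rw [sf_Q_add hn hI, mul_comm s u]; ring

theorem sf_gauss_sq [Fintype K] {n : ℕ} (hn : Fintype.card K = 2 ^ n) {I : ℂ} (hI : I ^ 2 = -1) :
    (∑ u : K, Qq I n u) ^ 2 = 2 ^ n * I ^ n := by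
  rw [sq, Finset.sum_mul_sum]
  have h1 : ∀ x : K, ∑ y : K, Qq I n x * Qq I n y = ∑ z : K, Qq I n z * psiq n ((1 + z) * x) := by
    intro x
    rw [← Equiv.sum_comp (Equiv.addRight x) (fun y => Qq I n x * Qq I n y)]
    refine Finset.sum_congr rfl fun z _ => ?_
    simp only [Equiv.coe_addRight]
    rw [sf_Q_add hn hI, add_mul, one_mul, sf_psi_add hn, ← sf_Q_sq hn hI x]; ring
  simp only [h1]
  rw [Finset.sum_comm]
  simp only [← Finset.mul_sum, sf_orth hn, CharTwo.add_eq_zero]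
  simp [sf_Q_one hn hI, mul_comm]

theorem sf_sum_fibre_Q [Fintype K] {n : ℕ} (hn : Fintype.card K = 2 ^ n) {I : ℂ} (hI : I ^ 2 = -1)
    (f g : K → K)
    (hfg : ∀ x z, psiq n (f x * z) = psiq n (x * g z)) (t : K) :
    ∑ x : K, Qq I n (f x) * psiq n (t * f x)
      = (∑ u : K, Qq I n u) * ∑ z : K with g z = 0, (Qq I n (t + z))⁻¹ := by
  rw [sf_fibre_sum hn f g hfg (fun u => Qq I n u * psiq n (t * u)), Finset.mul_sum]
  refine Finset.sum_congr rfl fun z _ => ?_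
  rw [← sf_gauss_twist hn hI]
  refine Finset.sum_congr rfl fun u _ => ?_
  rw [add_mul, sf_psi_add hn]; ring

theorem sf_tr2_double (h : ℕ) (x : K) : tr2 (2 * h) x = tr2 h x + tr2 h (x ^ 2 ^ h) := by
  simp only [tr2, two_mul, Finset.sum_range_add, pow_add, pow_mul]

theorem sf_tr_double (h : ℕ) (x : W2 K) :
    W2.tr (2 * h) x = W2.tr h (x + W2.frob^[h] x) := by
  rw [sf_tr_add]
  simp only [W2.tr, two_mul, Finset.sum_range_add]
  congr 1
  refine Finset.sum_congr rfl fun i _ => ?_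
  rw [add_comm h i, Function.iterate_add_apply]

theorem sf_tr2_tele (h : ℕ) (t : K) : tr2 h (t ^ 2 + t) = t ^ 2 ^ h + t := by
  induction h with
  | zero => simp [tr2, CharTwo.add_self_eq_zero]
  | succ h ih =>
    rw [tr2, Finset.sum_range_succ, ← tr2, ih, sf_add_pow, ← pow_mul, ← pow_succ']
    have := CharTwo.add_self_eq_zero (t ^ 2 ^ h)
    linear_combination this

theorem sf_Q_special [Fintype K] {h : ℕ} (hn : Fintype.card K = 2 ^ (2 * h)) {I : ℂ}
    (hI : I ^ 2 = -1) {t : K} (ht : t + t ^ 2 ^ h = 1) : Qq I (2 * h) t = - I ^ h := by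
  have hts : t ^ 2 ^ h = t + 1 := by
    have := CharTwo.add_self_eq_zero t
    linear_combination ht - this
  have hc : tr2 h (t ^ 2 + t) = 1 := by rw [sf_tr2_tele, add_comm]; exact ht
  simp only [sf_Qq_eq]
  rw [sf_tr_double]
  have e : (sfMk (t) (0)) + W2.frob^[h] (sfMk (t) (0))
      = sfMk (1) (t ^ 2 + t) := by
    apply sf_w_ext
    · rw [W2.fst_add, sf_frob_it_fst, sfMk_fst, sfMk_fst]; exact ht
    · rw [W2.snd_add, sf_frob_it_fst, sf_frob_it_snd]; simp [hts, sfMk_fst, sfMk_snd]; ring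
  rw [e, sf_xi_sum hI h _ (Or.inr hc)]
  simp [psiq, hc]

/-- The quadratic Gauss sum. -/
theorem sf_gauss [Fintype K] {h : ℕ} (hn : Fintype.card K = 2 ^ (2 * h)) {I : ℂ}
    (hI : I ^ 2 = -1) : ∑ u : K, Qq I (2 * h) u = - (2 ^ h * I ^ h) := by
  have hI0 : I ≠ 0 := by rintro rfl; norm_num at hI
  have hss : ∀ x : K, (x ^ 2 ^ h) ^ 2 ^ h = x := by
    intro x; rw [← pow_mul, ← pow_add, ← two_mul, sf_pow_card hn]
  have hadj : ∀ x z : K, psiq (2 * h) ((x + x ^ 2 ^ h) * z)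
      = psiq (2 * h) (x * (z + z ^ 2 ^ h)) := by
    intro x z
    apply sf_psi_congr
    rw [add_mul, mul_add, sf_tr2_add, sf_tr2_add]
    congr 1
    rw [← sf_tr2_pow hn (x ^ 2 ^ h * z) h, mul_pow, hss]
  have hL : ∀ x : K, x ^ 2 ^ h = x → psiq (2 * h) x = 1 := by
    intro x hx
    simp [psiq, sf_tr2_double, hx, CharTwo.add_self_eq_zero]
  have hL' : ∀ x : K, x + x ^ 2 ^ h = 0 ↔ x ^ 2 ^ h = x := by
    intro x; rw [CharTwo.add_eq_zero, eq_comm]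
  obtain ⟨t, ht⟩ : ∃ t : K, t + t ^ 2 ^ h = 1 := by
    by_contra hcon
    push Not at hcon
    have h1 := sf_fibre hn (fun x : K => x + x ^ 2 ^ h) _ hadj 1
    rw [Finset.filter_false_of_mem (fun x _ => hcon x)] at h1
    rw [Finset.sum_congr rfl (g := fun _ => (1 : ℂ))] at h1
    · simp only [Finset.card_empty, Nat.cast_zero, Finset.sum_const, nsmul_eq_mul, mul_one] at h1
      have h2 : #{z : K | z + z ^ 2 ^ h = 0} = 0 := by exact_mod_cast h1.symm
      rw [Finset.card_eq_zero] at h2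
      have : (0 : K) ∈ ({z : K | z + z ^ 2 ^ h = 0} : Finset K) := by simp
      rw [h2] at this
      simp at this
    · intro z hz
      rw [mul_one]
      exact hL z ((hL' z).1 (Finset.mem_filter.1 hz).2)
  have key := sf_sum_fibre_Q hn hI (fun x : K => x + x ^ 2 ^ h) _ hadj t
  have hl : ∀ x : K, Qq I (2 * h) (x + x ^ 2 ^ h) * psiq (2 * h) (t * (x + x ^ 2 ^ h)) = 1 := by
    intro x
    rw [← hadj, ht, one_mul, sf_Q_add hn hI, sf_Q_pow hn, ← sq, sf_Q_sq hn hI]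
    rw [hL (x * x ^ 2 ^ h) (by rw [mul_pow, hss, mul_comm])]
    rcases sf_psi_pm (2 * h) x with h' | h' <;> rw [h'] <;> norm_num
  simp only [hl] at key
  rw [Finset.sum_congr rfl (g := fun _ => (- I ^ h)⁻¹) (s₁ := Finset.filter _ _)] at key
  · simp only [Finset.sum_const, nsmul_eq_mul, Finset.card_univ, hn, mul_one] at key
    have hsq := sf_gauss_sq hn hI (K := K)
    set G := ∑ u : K, Qq I (2 * h) u
    set c := #{z : K | z + z ^ 2 ^ h = 0}
    have hIh : I ^ h ≠ 0 := pow_ne_zero _ hI0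
    push_cast at key
    have k1 : G * c = - (2 ^ (2 * h) * I ^ h) := by
      field_simp at key
      linear_combination key
    have k2 : ((c : ℂ)) ^ 2 = (2 ^ h) ^ 2 := by
      have h3 : (2 : ℂ) ^ (2 * h) * I ^ (2 * h) ≠ 0 :=
        mul_ne_zero (pow_ne_zero _ two_ne_zero) (pow_ne_zero _ hI0)
      apply mul_left_cancel₀ h3
      have k3 : (G * c) ^ 2 = (2 ^ (2 * h) * I ^ h) ^ 2 := by rw [k1]; ring
      rw [mul_pow, hsq] at k3
      rw [k3]; ring
    have k4 : c = 2 ^ h := by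
      have : c ^ 2 = (2 ^ h) ^ 2 := by exact_mod_cast k2
      exact Nat.pow_left_injective (n := 2) (by norm_num) this
    rw [k4] at k1
    push_cast at k1
    have h2 : (2 : ℂ) ^ h ≠ 0 := pow_ne_zero _ two_ne_zero
    apply mul_right_cancel₀ h2
    rw [k1]; ring
  · intro z hz
    rw [sf_Q_special hn hI]
    have := (Finset.mem_filter.1 hz).2
    rw [sf_add_pow]
    linear_combination ht + this

end helpersW

section helpersF

set_option linter.unusedSectionVars false

variable [Field K] [CharP K 2]

theorem sf_pow_inj (j : ℕ) {x y : K} (h : x ^ 2 ^ j = y ^ 2 ^ j) : x = y := by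
  have h1 : (x - y) ^ 2 ^ j = 0 := by rw [sub_pow_char_pow, h, sub_self]
  exact sub_eq_zero.1 (pow_eq_zero_iff (by positivity) |>.1 h1)

theorem sf_rt_pow [PerfectRing K 2] (j : ℕ) (x : K) : rt K j x ^ 2 ^ j = x :=
  iterate_frobeniusEquiv_symm_pow_p_pow (R := K) (p := 2) x j

theorem sf_rt_eq [PerfectRing K 2] {j : ℕ} {x y : K} (h : y ^ 2 ^ j = x) : rt K j x = y :=
  sf_pow_inj j (by rw [sf_rt_pow, h])

theorem sf_rt_mul [PerfectRing K 2] (j : ℕ) (x y : K) : rt K j (x * y) = rt K j x * rt K j y :=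
  sf_rt_eq (by rw [mul_pow, sf_rt_pow, sf_rt_pow])

theorem sf_rt_add [PerfectRing K 2] (j : ℕ) (x y : K) : rt K j (x + y) = rt K j x + rt K j y :=
  sf_rt_eq (by rw [sf_add_pow, sf_rt_pow, sf_rt_pow])

theorem sf_rt_zero [PerfectRing K 2] (j : ℕ) : rt K j (0 : K) = 0 :=
  sf_rt_eq (by simp)

theorem sf_adj_add [PerfectRing K 2] (k e : ℕ) (b : ℕ → K) (x y : K) :
    adj k e b (x + y) = adj k e b x + adj k e b y := by
  simp only [adj, mul_add, sf_rt_add, Finset.sum_add_distrib]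

theorem sf_adj_zero [PerfectRing K 2] (k e : ℕ) (b : ℕ → K) : adj k e b (0 : K) = 0 := by
  simp [adj, sf_rt_zero]

theorem sf_L_add (k e : ℕ) (b : ℕ → K) (x y : K) :
    Lpoly (2 ^ k) e b (x + y) = Lpoly (2 ^ k) e b x + Lpoly (2 ^ k) e b y := by
  simp only [Lpoly, ← pow_mul, sf_add_pow, mul_add, Finset.sum_add_distrib]

theorem sf_adjBar [Fintype K] (k e : ℕ) (b : ℕ → K) (v : K) :
    adjBar k e b (algebraMap K (AlgebraicClosure K) v)
      = algebraMap K (AlgebraicClosure K) (adj k e b v) := by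
  simp only [adjBar, adj, map_sum]
  refine Finset.sum_congr rfl fun i _ => ?_
  apply sf_rt_eq
  rw [← map_pow, sf_rt_pow, map_mul]

theorem sf_LBar (k e : ℕ) (b : ℕ → K) (v : K) :
    LpolyBar k e b (algebraMap K (AlgebraicClosure K) v)
      = algebraMap K (AlgebraicClosure K) (Lpoly (2 ^ k) e b v) := by
  simp [LpolyBar, Lpoly, map_sum]

variable [Fintype K] {n : ℕ}

theorem sf_adjoint (hn : Fintype.card K = 2 ^ n) (k e : ℕ) (b : ℕ → K) (x z : K) :
    psiq n (Lpoly (2 ^ k) e b x * z) = psiq n (x * adj k e b z) := by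
  apply sf_psi_congr
  simp only [Lpoly, adj, Finset.sum_mul, Finset.mul_sum, sf_tr2_sum]
  refine Finset.sum_congr rfl fun i _ => ?_
  rw [← sf_tr2_pow hn (x * rt K (k * i) (b i * z)) (k * i), mul_pow, sf_rt_pow, ← pow_mul]
  congr 1; ring

theorem sf_Q_sum (hn : Fintype.card K = 2 ^ n) {I : ℂ} (hI : I ^ 2 = -1) (N : ℕ) (u : ℕ → K) :
    Qq I n (∑ i ∈ Finset.range N, u i) = (∏ i ∈ Finset.range N, Qq I n (u i)) *
      psiq n (∑ j ∈ Finset.range N, ∑ i ∈ Finset.range j, u i * u j) := by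
  induction N with
  | zero => simp [sf_Q_zero, sf_psi_zero]
  | succ N ih =>
    rw [Finset.sum_range_succ, sf_Q_add hn hI, ih, Finset.prod_range_succ,
      Finset.sum_range_succ (fun j => ∑ i ∈ Finset.range j, u i * u j), sf_psi_add hn,
      Finset.sum_mul]
    ring

theorem sf_gamma (hn : Fintype.card K = 2 ^ n) (k e : ℕ) (b : ℕ → K) :
    gammaF k e b = ∑ j ∈ Finset.range (e + 1), ∑ i ∈ Finset.range j,
      rt K (k * i) (b i) * rt K (k * j) (b j) := by
  unfold gammaF
  apply Finset.sum_comm'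
  intro i j
  simp only [Finset.mem_range, Finset.mem_Ioo]
  omega

theorem sf_RF (hn : Fintype.card K = 2 ^ n) (k e : ℕ) (b : ℕ → K) (x : K) :
    x * RF k e b x = ∑ j ∈ Finset.range (e + 1), ∑ i ∈ Finset.range j,
      x * (rt K (k * i) (b i * b j) * x ^ (2 ^ k) ^ (j - i)) := by
  simp only [RF, aRF, Finset.mul_sum, Finset.sum_mul]
  rw [Finset.sum_sigma', Finset.sum_sigma']
  refine Finset.sum_nbij' (fun s => ⟨s.2 + s.1, s.2⟩) (fun s => ⟨s.1 - s.2, s.2⟩) ?_ ?_ ?_ ?_ ?_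
  · rintro ⟨d, j⟩ h
    simp only [Finset.mem_sigma, Finset.mem_Icc, Finset.mem_range] at h ⊢
    omega
  · rintro ⟨d, j⟩ h
    simp only [Finset.mem_sigma, Finset.mem_Icc, Finset.mem_range] at h ⊢
    omega
  · rintro ⟨d, j⟩ h
    simp
  · rintro ⟨d, j⟩ h
    simp only [Finset.mem_sigma, Finset.mem_range] at h
    simp only [Sigma.mk.injEq, heq_eq_eq, and_true]
    omega
  · rintro ⟨d, j⟩ h
    simp

theorem sf_Q_F (hn : Fintype.card K = 2 ^ n) {I : ℂ} (hI : I ^ 2 = -1) (k e : ℕ) (b : ℕ → K) (h1 : adj k e b 1 = 0) (x : K) :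
    Qq I n (Lpoly (2 ^ k) e b x) = psiq n (x * RF k e b x + gammaF k e b * x ^ 2) := by
  have hw := sf_Q_sum hn hI (e + 1) (fun i => rt K (k * i) (b i) * x)
  have hs : ∑ i ∈ Finset.range (e + 1), rt K (k * i) (b i) * x = 0 := by
    rw [← Finset.sum_mul]
    simp only [adj, mul_one] at h1
    rw [h1, zero_mul]
  have hg : ∑ j ∈ Finset.range (e + 1), ∑ i ∈ Finset.range j,
      (rt K (k * i) (b i) * x) * (rt K (k * j) (b j) * x) = gammaF k e b * x ^ 2 := by
    rw [sf_gamma hn, Finset.sum_mul]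
    refine Finset.sum_congr rfl fun j _ => ?_
    rw [Finset.sum_mul]
    refine Finset.sum_congr rfl fun i _ => ?_
    ring
  rw [hs, sf_Q_zero, hg] at hw
  have hu := sf_Q_sum hn hI (e + 1) (fun i => b i * x ^ (2 ^ k) ^ i)
  have hp : ∀ i, Qq I n (b i * x ^ (2 ^ k) ^ i) = Qq I n (rt K (k * i) (b i) * x) := by
    intro i
    rw [← sf_Q_pow hn I (rt K (k * i) (b i) * x) (k * i), mul_pow, sf_rt_pow, ← pow_mul]
  have hr : psiq n (∑ j ∈ Finset.range (e + 1), ∑ i ∈ Finset.range j,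
      (b i * x ^ (2 ^ k) ^ i) * (b j * x ^ (2 ^ k) ^ j)) = psiq n (x * RF k e b x) := by
    apply sf_psi_congr
    rw [sf_RF hn]
    simp only [sf_tr2_sum]
    refine Finset.sum_congr rfl fun j _ => Finset.sum_congr rfl fun i hi => ?_
    have hij : i < j := Finset.mem_range.1 hi
    obtain ⟨d, rfl⟩ := Nat.exists_eq_add_of_lt hij
    rw [← sf_tr2_pow hn (x * _) (k * i), mul_pow, mul_pow, sf_rt_pow]
    congr 1
    have : i + d + 1 - i = d + 1 := by omega
    rw [this]
    simp only [← pow_mul, ← pow_add]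
    have e1 : x ^ 2 ^ (k * (i + d + 1)) = x ^ (2 ^ (k * (d + 1)) * 2 ^ (k * i)) := by
      rw [← pow_add]; congr 2; ring
    rw [e1]; ring
  simp only [hp, hr] at hu
  unfold Lpoly
  rw [hu, sf_psi_add hn]
  have hgs : psiq n (gammaF k e b * x ^ 2) * psiq n (gammaF k e b * x ^ 2) = 1 := by
    rcases sf_psi_pm n (gammaF k e b * x ^ 2) with h | h <;> rw [h] <;> norm_num
  set P := ∏ i ∈ Finset.range (e + 1), Qq I n (rt K (k * i) (b i) * x)
  set g := psiq n (gammaF k e b * x ^ 2)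
  have : P = g := by
    calc P = P * (g * g) := by rw [hgs, mul_one]
      _ = (P * g) * g := by ring
      _ = g := by rw [← hw, one_mul]
  rw [this, mul_comm]

/-- The character sum attached to `R_F(x) + a x`. -/
def sfE (n k e : ℕ) (b : ℕ → K) (a : K) : ℂ := ∑ x : K, psiq n (x * (RF k e b x + a * x))

theorem sf_E_eq (hn : Fintype.card K = 2 ^ n) {I : ℂ} (hI : I ^ 2 = -1) (k e : ℕ) (b : ℕ → K) (h1 : adj k e b 1 = 0) (s : K) :
    sfE n k e b (gammaF k e b + s ^ 2)
      = ∑ x : K, Qq I n (Lpoly (2 ^ k) e b x) * psiq n (s * x) := by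
  unfold sfE
  refine Finset.sum_congr rfl fun x _ => ?_
  rw [sf_Q_F hn hI k e b h1, ← sf_psi_congr (sf_tr2_sq hn (s * x)), ← sf_psi_add hn]
  congr 1; ring

theorem sf_Fp_card (hn : Fintype.card K = 2 ^ n) {k m : ℕ} (hk : 1 ≤ k) (hkm : n = k * m) : #{z : K | z ^ 2 ^ k = z} = 2 ^ k := by
  have h1 := IsCyclic.card_powMonoidHom_ker (G := Kˣ) (2 ^ k - 1)
  have hp : 1 ≤ 2 ^ k := Nat.one_le_two_pow
  rw [Nat.card_units, Nat.card_eq_fintype_card (α := K), hn, hkm, Nat.gcd_eq_right] at h1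
  · set S : Finset Kˣ := Finset.univ.filter (fun z : Kˣ => z ^ (2 ^ k - 1) = 1) with hS
    have h2 : #{z : K | z ^ 2 ^ k = z} = #S + 1 := by
      have : ({z : K | z ^ 2 ^ k = z} : Finset K) = insert 0 (S.image Units.val) := by
        ext z
        simp only [hS, Finset.mem_filter, Finset.mem_univ, true_and, Finset.mem_insert,
          Finset.mem_image]
        have hz : z ^ 2 ^ k = z * z ^ (2 ^ k - 1) := by
          rw [← pow_succ', Nat.sub_add_cancel hp]
        constructor
        · intro h
          by_cases h0 : z = 0
          · exact Or.inl h0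
          · refine Or.inr ⟨Units.mk0 z h0, ?_, rfl⟩
            ext
            simp only [Units.val_pow_eq_pow_val, Units.val_mk0, Units.val_one]
            rw [hz] at h
            exact mul_left_cancel₀ h0 (by rw [h, mul_one])
        · rintro (h | ⟨u, hu, rfl⟩)
          · subst h; simp
          · rw [hz, ← Units.val_pow_eq_pow_val, hu]; simp
      rw [this, Finset.card_insert_of_notMem, Finset.card_image_of_injective _ Units.val_injective]
      simp
    have h3 : #S = 2 ^ k - 1 := by
      rw [← Fintype.card_subtype, ← Nat.card_eq_fintype_card]
      exact h1
    rw [h2, h3, Nat.sub_add_cancel hp]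
  · rw [pow_mul]
    exact Nat.sub_one_dvd_pow_sub_one (2 ^ k) m

theorem sf_N (hn : Fintype.card K = 2 ^ n) {k m : ℕ} (hk : 1 ≤ k) (hkm : n = k * m) (e : ℕ) (b : ℕ → K) (a : K) :
    (Ncount K (2 ^ k) (fun x => RF k e b x + a * x) : ℂ)
      = 2 ^ n + (2 ^ k - 1) * sfE n k e b a := by
  have hadj : ∀ y z : K, psiq n ((y ^ 2 ^ k - y) * z) = psiq n (y * (rt K k z - z)) := by
    intro y z
    apply sf_psi_congr
    simp only [CharTwo.sub_eq_add, add_mul, mul_add, sf_tr2_add]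
    congr 1
    rw [← sf_tr2_pow hn (y * rt K k z) k, mul_pow, sf_rt_pow]
  have h1 : Ncount K (2 ^ k) (fun x => RF k e b x + a * x)
      = ∑ x : K, #{y : K | y ^ 2 ^ k - y = x * (RF k e b x + a * x)} := by
    unfold Ncount
    rw [Nat.card_eq_fintype_card, Fintype.card_subtype, Finset.card_filter,
      Fintype.sum_prod_type]
    refine Finset.sum_congr rfl fun x _ => ?_
    rw [Finset.card_filter]
  rw [h1]
  push_cast
  simp only [sf_fibre hn (fun y : K => y ^ 2 ^ k - y) _ hadj]
  rw [Finset.sum_comm]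
  have hz : ∀ z : K, rt K k z - z = 0 ↔ z ^ 2 ^ k = z := by
    intro z
    rw [sub_eq_zero]
    constructor
    · intro h
      conv_rhs => rw [← sf_rt_pow k z]
      rw [h]
    · intro h; exact sf_rt_eq h
  simp only [hz]
  have h0 : (0 : K) ∈ ({z : K | z ^ 2 ^ k = z} : Finset K) := by simp
  rw [← Finset.add_sum_erase _ _ h0]
  congr 1
  · simp [sf_psi_zero, hn]
  · rw [Finset.sum_congr rfl (g := fun _ => sfE n k e b a)]
    · rw [Finset.sum_const, Finset.card_erase_of_mem h0, sf_Fp_card hn hk hkm, nsmul_eq_mul,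
        Nat.cast_sub Nat.one_le_two_pow]
      push_cast; rfl
    · intro z hz
      simp only [Finset.mem_erase, Finset.mem_filter, Finset.mem_univ, true_and] at hz
      obtain ⟨hz0, hzp⟩ := hz
      set r := rt K 1 z with hr
      have hr2 : r ^ 2 = z := by simpa using sf_rt_pow 1 z
      have hr0 : r ≠ 0 := by
        intro h; rw [h] at hr2; apply hz0; rw [← hr2]; simp
      have hrp : r ^ 2 ^ k = r := by
        apply sf_pow_inj 1
        rw [pow_one, ← pow_mul, mul_comm, pow_mul, hr2, hzp]
      have hrpi : ∀ i, r ^ (2 ^ k) ^ i = r := by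
        intro i
        induction i with
        | zero => simp
        | succ i ih => rw [pow_succ, pow_mul, ih, hrp]
      unfold sfE
      rw [← Equiv.sum_comp (Equiv.mulLeft₀ r hr0)
        (fun x => psiq n (x * (RF k e b x + a * x)))]
      refine Finset.sum_congr rfl fun x _ => ?_
      change _ = psiq n ((r * x) * (RF k e b (r * x) + a * (r * x)))
      congr 1
      have hR : RF k e b (r * x) = r * RF k e b x := by
        simp only [RF, Finset.mul_sum]
        refine Finset.sum_congr rfl fun i _ => ?_
        rw [mul_pow, hrpi]; ring
      rw [hR, ← hr2]; ring

end helpersF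

section helpersM

set_option linter.unusedSectionVars false

variable [Field K] [CharP K 2]

/-- The linearised polynomial as a polynomial. -/
def sfPoly (k e : ℕ) (b : ℕ → K) : Polynomial K :=
  ∑ i ∈ Finset.range (e + 1), Polynomial.C (b i) * Polynomial.X ^ (2 ^ k) ^ i

theorem sf_poly_aeval (k e : ℕ) (b : ℕ → K) (x : AlgebraicClosure K) :
    Polynomial.aeval x (sfPoly k e b) = LpolyBar k e b x := by
  simp [sfPoly, LpolyBar, Lpoly, map_sum]

theorem sf_poly_deg {k e : ℕ} (hk : 1 ≤ k) (he : 1 ≤ e) (b : ℕ → K) (hb : b e ≠ 0) :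
    (sfPoly k e b).natDegree = (2 ^ k) ^ e := by
  have h2 : 1 < 2 ^ k := Nat.one_lt_two_pow (by omega)
  unfold sfPoly
  rw [Finset.sum_range_succ, Polynomial.natDegree_add_eq_right_of_natDegree_lt,
    Polynomial.natDegree_C_mul_X_pow _ _ hb]
  rw [Polynomial.natDegree_C_mul_X_pow _ _ hb]
  refine lt_of_le_of_lt (Polynomial.natDegree_sum_le_of_forall_le (n := (2 ^ k) ^ (e - 1)) _ _ ?_) ?_
  · intro i hi
    refine (Polynomial.natDegree_C_mul_X_pow_le _ _).trans ?_
    apply Nat.pow_le_pow_right (by omega)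
    have := Finset.mem_range.1 hi
    omega
  · exact Nat.pow_lt_pow_right h2 (by omega)

theorem sf_poly_sep {k e : ℕ} (hk : 1 ≤ k) (b : ℕ → K) (hb : b 0 ≠ 0) :
    (sfPoly k e b).Separable := by
  have hd : Polynomial.derivative (sfPoly k e b) = Polynomial.C (b 0) := by
    unfold sfPoly
    rw [Finset.sum_range_succ', Polynomial.derivative_add, Polynomial.derivative_sum,
      Finset.sum_eq_zero]
    · simp
    · intro i _
      rw [Polynomial.derivative_C_mul_X_pow]
      have : (((2 ^ k) ^ (i + 1) : ℕ) : K) = 0 := by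
        have h2 : ((2 : ℕ) : K) = 0 := CharP.cast_eq_zero K 2
        push_cast at h2 ⊢
        rw [h2, zero_pow (by omega), zero_pow (by omega)]
      rw [this]; simp
  unfold Polynomial.Separable
  rw [hd]
  exact ⟨0, Polynomial.C (b 0)⁻¹, by rw [zero_mul, zero_add, ← Polynomial.C_mul, inv_mul_cancel₀ hb, Polynomial.C_1]⟩

theorem sf_ker_card [Fintype K] {k e : ℕ} (hk : 1 ≤ k) (he : 1 ≤ e) (b : ℕ → K)
    (hb1 : b 0 * b e ≠ 0)
    (hb4 : ∀ x : AlgebraicClosure K, adjBar k e b (LpolyBar k e b x) = 0 →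
      x ∈ Set.range (algebraMap K (AlgebraicClosure K))) :
    #{x : K | Lpoly (2 ^ k) e b x = 0} = (2 ^ k) ^ e := by
  have h1 := Polynomial.card_rootSet_eq_natDegree (K := AlgebraicClosure K)
    (sf_poly_sep (e := e) hk b (left_ne_zero_of_mul hb1)) (IsAlgClosed.splits _)
  have hdeg := sf_poly_deg hk he b (right_ne_zero_of_mul hb1)
  have hP0 : sfPoly k e b ≠ 0 := by
    intro h
    rw [h, Polynomial.natDegree_zero] at hdeg
    exact (pow_ne_zero e (pow_ne_zero k two_ne_zero)) hdeg.symm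
  rw [hdeg] at h1
  rw [← h1, ← Nat.card_eq_fintype_card, ← Fintype.card_subtype, ← Nat.card_eq_fintype_card]
  refine Nat.card_eq_of_bijective
    (fun x => ⟨algebraMap K (AlgebraicClosure K) x.1, ?_⟩) ⟨?_, ?_⟩
  · rw [Polynomial.mem_rootSet]
    refine ⟨hP0, ?_⟩
    rw [sf_poly_aeval, sf_LBar, x.2, map_zero]
  · rintro ⟨x, hx⟩ ⟨y, hy⟩ h
    simp only [Subtype.mk.injEq] at h ⊢
    exact (algebraMap K (AlgebraicClosure K)).injective h
  · rintro ⟨y, hy⟩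
    have hy' := (Polynomial.mem_rootSet.1 hy).2
    rw [sf_poly_aeval] at hy'
    obtain ⟨x, rfl⟩ := hb4 y (by rw [hy']; exact sf_adj_zero _ _ _)
    refine ⟨⟨x, ?_⟩, rfl⟩
    rw [sf_LBar] at hy'
    exact (map_eq_zero_iff _ (algebraMap K (AlgebraicClosure K)).injective).1 hy'

theorem sf_iso_pre [Fintype K] {k e : ℕ} (hk : 1 ≤ k) (he : 1 ≤ e) (b : ℕ → K)
    (hb1 : b 0 * b e ≠ 0)
    (hb4 : ∀ x : AlgebraicClosure K, adjBar k e b (LpolyBar k e b x) = 0 →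
      x ∈ Set.range (algebraMap K (AlgebraicClosure K))) (v : K) (hv : adj k e b v = 0) :
    ∃ x : K, Lpoly (2 ^ k) e b x = v := by
  have hdeg := sf_poly_deg hk he b (right_ne_zero_of_mul hb1)
  have hd2 : (sfPoly k e b - Polynomial.C v).natDegree = (2 ^ k) ^ e := by
    rw [Polynomial.natDegree_sub_C, hdeg]
  obtain ⟨x, hx⟩ := IsAlgClosed.exists_aeval_eq_zero (AlgebraicClosure K)
    (sfPoly k e b - Polynomial.C v) (by
      intro h
      have := Polynomial.natDegree_eq_of_degree_eq_some h
      rw [hd2] at this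
      exact (pow_ne_zero e (pow_ne_zero k two_ne_zero)) this)
  rw [map_sub, sf_poly_aeval, Polynomial.aeval_C, sub_eq_zero] at hx
  obtain ⟨y, rfl⟩ := hb4 x (by rw [hx, sf_adjBar, hv, map_zero])
  rw [sf_LBar] at hx
  exact ⟨y, (algebraMap K (AlgebraicClosure K)).injective hx⟩

variable [Fintype K] {n : ℕ}

theorem sf_iso (hn : Fintype.card K = 2 ^ n) {k e : ℕ} (hk : 1 ≤ k) (he : 1 ≤ e) (b : ℕ → K)
    (hb1 : b 0 * b e ≠ 0)
    (hb4 : ∀ x : AlgebraicClosure K, adjBar k e b (LpolyBar k e b x) = 0 →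
      x ∈ Set.range (algebraMap K (AlgebraicClosure K))) (v w : K) (hv : adj k e b v = 0)
    (hw : adj k e b w = 0) : psiq n (v * w) = 1 := by
  obtain ⟨x, rfl⟩ := sf_iso_pre hk he b hb1 hb4 v hv
  rw [sf_adjoint hn, hw, mul_zero, sf_psi_zero]

theorem sf_W_card (hn : Fintype.card K = 2 ^ n) {k e : ℕ} (hk : 1 ≤ k) (he : 1 ≤ e) (b : ℕ → K)
    (hb1 : b 0 * b e ≠ 0)
    (hb4 : ∀ x : AlgebraicClosure K, adjBar k e b (LpolyBar k e b x) = 0 →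
      x ∈ Set.range (algebraMap K (AlgebraicClosure K))) :
    #{z : K | adj k e b z = 0} = (2 ^ k) ^ e := by
  have h := sf_fibre hn (Lpoly (2 ^ k) e b) (adj k e b) (sf_adjoint hn k e b) 0
  rw [sf_ker_card hk he b hb1 hb4] at h
  simp only [mul_zero, sf_psi_zero, Finset.sum_const, nsmul_eq_mul, mul_one] at h
  exact_mod_cast h.symm

/-- If the character sum does not vanish then `a` is in the image of `α_F`. -/
theorem sf_surj (hn : Fintype.card K = 2 ^ n) {I : ℂ} (hI : I ^ 2 = -1) (k e : ℕ) (b : ℕ → K) (h1 : adj k e b 1 = 0) (a : K)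
    (ha : sfE n k e b a ≠ 0) : ∃ t, alphaF k e b t = a := by
  set s := rt K 1 (a + gammaF k e b) with hs
  have hs2 : s ^ 2 = a + gammaF k e b := by simpa using sf_rt_pow 1 (a + gammaF k e b)
  have has : gammaF k e b + s ^ 2 = a := by
    rw [hs2]
    have := CharTwo.add_self_eq_zero (gammaF k e b)
    linear_combination this
  by_cases hker : ∀ x : K, Lpoly (2 ^ k) e b x = 0 → psiq n (x * s) = 1
  · by_contra hcon
    push Not at hcon
    have hne : ∀ t, adj k e b t ≠ s := by
      intro t ht
      apply hcon t
      unfold alphaF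
      rw [ht, has]
    have h := sf_fibre hn (adj k e b) (Lpoly (2 ^ k) e b) (fun x z => by
      rw [mul_comm, ← sf_adjoint hn, mul_comm]) s
    rw [Finset.filter_false_of_mem (fun x _ => hne x), Finset.card_empty,
      Finset.sum_congr rfl (g := fun _ => (1 : ℂ))] at h
    · simp only [Nat.cast_zero, Finset.sum_const, nsmul_eq_mul, mul_one] at h
      have h2 : #{z : K | Lpoly (2 ^ k) e b z = 0} = 0 := by exact_mod_cast h.symm
      rw [Finset.card_eq_zero] at h2
      have hL0 : Lpoly (2 ^ k) e b (0 : K) = 0 := by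
        unfold Lpoly
        refine Finset.sum_eq_zero fun i _ => ?_
        rw [zero_pow (pow_ne_zero i (pow_ne_zero k two_ne_zero)), mul_zero]
      have := (Finset.mem_filter (p := fun z : K => Lpoly (2 ^ k) e b z = 0)).2
        ⟨Finset.mem_univ (0 : K), hL0⟩
      rw [h2] at this
      simp at this
    · intro z hz
      exact hker z (Finset.mem_filter.1 hz).2
  · exfalso
    push Not at hker
    obtain ⟨x0, hx0, hp⟩ := hker
    have hp' : psiq n (x0 * s) = -1 := (sf_psi_pm n _).resolve_left hp
    apply ha
    rw [← has, sf_E_eq hn hI k e b h1]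
    have e1 := Equiv.sum_comp (Equiv.addRight x0)
      (fun x => Qq I n (Lpoly (2 ^ k) e b x) * psiq n (s * x))
    simp only [Equiv.coe_addRight, sf_L_add, hx0, add_zero, mul_add, sf_psi_add hn,
      mul_comm s x0, hp', mul_neg, mul_one, Finset.sum_neg_distrib] at e1
    exact self_eq_neg.1 e1.symm

theorem sf_E_alpha (hn : Fintype.card K = 2 ^ n) {I : ℂ} (hI : I ^ 2 = -1) (k e : ℕ) (b : ℕ → K) (h1 : adj k e b 1 = 0)
    (hiso : ∀ v w : K, adj k e b v = 0 → adj k e b w = 0 → psiq n (v * w) = 1) (t : K) :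
    sfE n k e b (alphaF k e b t) = (∑ u : K, Qq I n u) * (Qq I n t)⁻¹ *
      ∑ z : K with adj k e b z = 0, Qq I n z * psiq n (t * z) := by
  unfold alphaF
  rw [sf_E_eq hn hI k e b h1]
  have h2 : ∀ x : K, psiq n (adj k e b t * x) = psiq n (t * Lpoly (2 ^ k) e b x) := by
    intro x; rw [mul_comm, ← sf_adjoint hn, mul_comm]
  simp only [h2]
  rw [sf_sum_fibre_Q hn hI _ _ (sf_adjoint hn k e b) t, mul_assoc]
  congr 1
  rw [Finset.mul_sum]
  refine Finset.sum_congr rfl fun z hz => ?_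
  have hz' := (Finset.mem_filter.1 hz).2
  rw [sf_Q_add hn hI, mul_inv, mul_inv, mul_assoc]
  congr 1
  have hq : Qq I n z ^ 2 = 1 := by
    rw [sf_Q_sq hn hI, ← mul_one z]; exact hiso z 1 hz' h1
  have hps : psiq n (t * z) ^ 2 = 1 := by
    rcases sf_psi_pm n (t * z) with h | h <;> rw [h] <;> norm_num
  congr 1
  · exact inv_eq_of_mul_eq_one_left (by rw [← sq, hq])
  · exact inv_eq_of_mul_eq_one_left (by rw [← sq, hps])

theorem sf_char_sum_zero (hn : Fintype.card K = 2 ^ n) {I : ℂ} (hI : I ^ 2 = -1) (k e : ℕ) (b : ℕ → K)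
    (hiso : ∀ v w : K, adj k e b v = 0 → adj k e b w = 0 → psiq n (v * w) = 1) (t v : K)
    (hv : adj k e b v = 0) (hne : Qq I n v * psiq n (t * v) ≠ 1) :
    ∑ z : K with adj k e b z = 0, Qq I n z * psiq n (t * z) = 0 := by
  have e1 : ∑ z : K with adj k e b z = 0, Qq I n z * psiq n (t * z)
      = ∑ z : K with adj k e b z = 0, Qq I n (z + v) * psiq n (t * (z + v)) := by
    rw [Finset.sum_filter, Finset.sum_filter,
      ← Equiv.sum_comp (Equiv.addRight v)]
    simp only [Equiv.coe_addRight, sf_adj_add, hv, add_zero]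
  have e2 : ∑ z : K with adj k e b z = 0, Qq I n (z + v) * psiq n (t * (z + v))
      = (∑ z : K with adj k e b z = 0, Qq I n z * psiq n (t * z)) *
        (Qq I n v * psiq n (t * v)) := by
    rw [Finset.sum_mul]
    refine Finset.sum_congr rfl fun z hz => ?_
    rw [sf_Q_add hn hI, mul_add, sf_psi_add hn, hiso z v (Finset.mem_filter.1 hz).2 hv]
    ring
  rw [e2] at e1
  by_contra h0
  exact hne (mul_left_cancel₀ h0 (by rw [← e1, mul_one]))

end helpersM

/-- Under conditions (i)-(iv) on `F`, with `R = R_F`: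
`n = [𝔽_q : 𝔽_2]` is even, `𝔽_q = S_0 ⊔ S_{F,-} ⊔ S_{F,+}`, and
`α_F(S_0) ⊆ T_{R,0}`, `α_F(S_{F,-}) = T_{R,max}`, `α_F(S_{F,+}) = T_{R,min}`. -/
theorem statement2 {K : Type*} [Field K] [Fintype K] [CharP K 2]
    (k m e : ℕ) (hk : 1 ≤ k) (hm : 1 ≤ m) (he : 1 ≤ e)
    (hcard : Fintype.card K = 2 ^ (k * m))
    (b : ℕ → K)
    (hb1 : b 0 * b e ≠ 0)
    (hb2 : adjBar k e b 1 = 0)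
    (hb3 : ∀ x : AlgebraicClosure K, adjBar k e b x = 0 →
      x ∈ Set.range (algebraMap K (AlgebraicClosure K)))
    (hb4 : ∀ x : AlgebraicClosure K, adjBar k e b (LpolyBar k e b x) = 0 →
      x ∈ Set.range (algebraMap K (AlgebraicClosure K)))
    (I : ℂ) (hI : I ^ 2 = -1) :
    Even (k * m) ∧
    S0 K I k m e b ∪ SFminus K I k m e b ∪ SFplus K I k m e b = Set.univ ∧
    Disjoint (S0 K I k m e b) (SFminus K I k m e b) ∧
    Disjoint (S0 K I k m e b) (SFplus K I k m e b) ∧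
    Disjoint (SFminus K I k m e b) (SFplus K I k m e b) ∧
    alphaF k e b '' S0 K I k m e b ⊆ TR0 K k m e b ∧
    alphaF k e b '' SFminus K I k m e b = TRmax K k m e b ∧
    alphaF k e b '' SFplus K I k m e b = TRmin K k m e b := by
  have hinj := (algebraMap K (AlgebraicClosure K)).injective
  have hadj0 : ∀ v : K, adjBar k e b (algebraMap K (AlgebraicClosure K) v) = 0 ↔
      adj k e b v = 0 := by
    intro v
    rw [sf_adjBar, map_eq_zero_iff _ hinj]
  have h1 : adj k e b 1 = 0 := (hadj0 1).1 (by rw [map_one]; exact hb2)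
  have hiso : ∀ v w : K, adj k e b v = 0 → adj k e b w = 0 → psiq (k * m) (v * w) = 1 :=
    fun v w hv hw => sf_iso hcard hk he b hb1 hb4 v w hv hw
  have hW := sf_W_card hcard hk he b hb1 hb4
  have heven : 2 ∣ k * m := by
    have h := hiso 1 1 h1 h1
    rw [mul_one] at h
    have h0 : tr2 (k * m) (1 : K) = 0 := by
      by_contra h0
      simp only [psiq, if_neg h0] at h
      norm_num at h
    rw [← CharP.cast_eq_zero_iff K 2]
    simpa [tr2] using h0
  obtain ⟨h, hkm⟩ := heven
  have hhalf : k * m / 2 = h := by omega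
  have hI0 : I ≠ 0 := by rintro rfl; norm_num at hI
  have hIh : I ^ h ≠ 0 := pow_ne_zero _ hI0
  have hG : ∑ u : K, Qq I (k * m) u = - (2 ^ h * I ^ h) := by
    rw [hkm] at hcard ⊢
    exact sf_gauss hcard hI
  have hSF : ∀ t, t ∈ SF K I k m e b ↔
      ∀ v : K, adj k e b v = 0 → Qq I (k * m) v = psiq (k * m) (t * v) := by
    intro t
    simp only [SF, Set.mem_setOf_eq, hadj0]
  have hEzero : ∀ t, t ∉ SF K I k m e b → sfE (k * m) k e b (alphaF k e b t) = 0 := by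
    intro t ht
    rw [hSF] at ht
    push Not at ht
    obtain ⟨v, hv, hne⟩ := ht
    rw [sf_E_alpha hcard hI k e b h1 hiso, sf_char_sum_zero hcard hI k e b hiso t v hv, mul_zero]
    intro hc
    apply hne
    rcases sf_psi_pm (k * m) (t * v) with h' | h' <;> rw [h'] at hc ⊢
    · linear_combination hc
    · linear_combination -hc
  have hE : ∀ t, t ∈ SF K I k m e b → sfE (k * m) k e b (alphaF k e b t)
      = - (2 ^ h * I ^ h) * (Qq I (k * m) t)⁻¹ * (2 ^ k) ^ e := by
    intro t ht
    rw [hSF] at ht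
    rw [sf_E_alpha hcard hI k e b h1 hiso, hG]
    congr 1
    rw [Finset.sum_congr rfl (g := fun _ => (1 : ℂ))]
    · rw [Finset.sum_const, hW, nsmul_eq_mul, mul_one]
      push_cast; rfl
    · intro z hz
      rw [ht z (Finset.mem_filter.1 hz).2]
      rcases sf_psi_pm (k * m) (t * z) with h' | h' <;> rw [h'] <;> norm_num
  have hQ : ∀ t, t ∈ SF K I k m e b → Qq I (k * m) t = I ^ h ∨ Qq I (k * m) t = - I ^ h := by
    intro t ht
    rw [hSF] at ht
    have h2 := ht 1 h1
    rw [mul_one, sf_Q_one hcard hI, ← sf_Q_sq hcard hI] at h2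
    apply sq_eq_sq_iff_eq_or_eq_neg.1
    rw [← h2, hkm]; ring
  set M : ℂ := (2 ^ k) ^ e * 2 ^ h with hM
  have hM0 : M ≠ 0 := mul_ne_zero (pow_ne_zero _ (pow_ne_zero _ two_ne_zero))
    (pow_ne_zero _ two_ne_zero)
  have hMM : M ≠ -M := fun hc => hM0 (self_eq_neg.1 hc)
  have hEm : ∀ t, t ∈ SFminus K I k m e b → sfE (k * m) k e b (alphaF k e b t) = M := by
    rintro t ⟨ht, hq⟩
    rw [hhalf] at hq
    rw [hE t ht, hq, hM]
    field_simp
  have hEp : ∀ t, t ∈ SFplus K I k m e b → sfE (k * m) k e b (alphaF k e b t) = -M := by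
    rintro t ⟨ht, hq⟩
    rw [hhalf] at hq
    rw [hE t ht, hq, hM]
    field_simp
  have hcases : ∀ t, t ∈ SF K I k m e b → t ∈ SFminus K I k m e b ∨ t ∈ SFplus K I k m e b := by
    intro t ht
    rcases hQ t ht with hq | hq
    · exact Or.inr ⟨ht, by rw [hhalf]; exact hq⟩
    · exact Or.inl ⟨ht, by rw [hhalf]; exact hq⟩
  have hN := sf_N hcard hk rfl e b
  have hp1 : ((2 : ℂ) ^ k - 1) ≠ 0 := by
    have h2 : (2 : ℕ) ^ k ≠ 1 := (Nat.one_lt_two_pow (by omega)).ne'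
    intro hc
    apply h2
    have : (2 : ℂ) ^ k = 1 := by linear_combination hc
    exact_mod_cast this
  have hT0 : ∀ a : K, sfE (k * m) k e b a = 0 → a ∈ TR0 K k m e b := by
    intro a ha
    have := hN a
    rw [ha, mul_zero, add_zero] at this
    simp only [TR0, Set.mem_setOf_eq]
    exact_mod_cast this
  have hTmax : ∀ a : K, a ∈ TRmax K k m e b ↔ sfE (k * m) k e b a = M := by
    intro a
    have hNa := hN a
    simp only [TRmax, Set.mem_setOf_eq, hhalf]
    rw [← Int.cast_inj (α := ℂ)]
    push_cast
    rw [hNa]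
    constructor
    · intro hh
      apply mul_left_cancel₀ hp1
      rw [hM]
      linear_combination hh
    · intro hh
      rw [hh, hM]; ring
  have hTmin : ∀ a : K, a ∈ TRmin K k m e b ↔ sfE (k * m) k e b a = -M := by
    intro a
    have hNa := hN a
    simp only [TRmin, Set.mem_setOf_eq, hhalf]
    rw [← Int.cast_inj (α := ℂ)]
    push_cast
    rw [hNa]
    constructor
    · intro hh
      apply mul_left_cancel₀ hp1
      rw [hM]
      linear_combination hh
    · intro hh
      rw [hh, hM]; ring
  refine ⟨⟨h, by omega⟩, ?_, ?_, ?_, ?_, ?_, ?_, ?_⟩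
  · ext t
    simp only [Set.mem_union, Set.mem_univ, iff_true]
    by_cases ht : t ∈ SF K I k m e b
    · rcases hcases t ht with h' | h'
      · exact Or.inl (Or.inr h')
      · exact Or.inr h'
    · exact Or.inl (Or.inl ht)
  · rw [Set.disjoint_left]
    intro t ht ht'
    exact ht ht'.1
  · rw [Set.disjoint_left]
    intro t ht ht'
    exact ht ht'.1
  · rw [Set.disjoint_left]
    intro t ht ht'
    exact hMM ((hEm t ht).symm.trans (hEp t ht'))
  · rintro _ ⟨t, ht, rfl⟩
    exact hT0 _ (hEzero t ht)
  · ext a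
    rw [hTmax]
    constructor
    · rintro ⟨t, ht, rfl⟩
      exact hEm t ht
    · intro ha
      obtain ⟨t, rfl⟩ := sf_surj hcard hI k e b h1 a (by rw [ha]; exact hM0)
      refine ⟨t, ?_, rfl⟩
      by_cases ht : t ∈ SF K I k m e b
      · rcases hcases t ht with h' | h'
        · exact h'
        · exact absurd (ha.symm.trans (hEp t h')) hMM
      · exact absurd (ha.symm.trans (hEzero t ht)) hM0
  · ext a
    rw [hTmin]
    constructor
    · rintro ⟨t, ht, rfl⟩
      exact hEp t ht
    · intro ha
      obtain ⟨t, rfl⟩ := sf_surj hcard hI k e b h1 a (by rw [ha]; exact neg_ne_zero.2 hM0)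
      refine ⟨t, ?_, rfl⟩
      by_cases ht : t ∈ SF K I k m e b
      · rcases hcases t ht with h' | h'
        · exact absurd ((hEm t h').symm.trans ha) hMM
        · exact h'
      · exact absurd (ha.symm.trans (hEzero t ht)) (neg_ne_zero.2 hM0)

end
end
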